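/- Let X_1,...,X_n (n ≥ 4) be i.i.d. uniform points on the unit sphere S² ⊂ ℝ³ and P_{n,3} their convex hull. Then E[Vol₃(P_{n,3})] = (4π/3)·(n-1)(n-2)(n-3)/((n+1)(n+2)(n+3)). -/

import Mathlib

open MeasureTheory

theorem exists_sub_mul_nonneg {ι : Type*} [Fintype ι] (v u : ι → ℝ) (hv : ∀ i, 0 ≤ v i)
    (hu : ∃ i, 0 < u i) :
    ∃ τ : ℝ, (∀ i, 0 ≤ v i - τ * u i) ∧ ∃ i, 0 < u i ∧ v i = τ * u i := by
  classical
  obtain ⟨i, hi, hmin⟩ := Finset.exists_min_image (Finset.univ.filter fun i => 0 < u i)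
    (fun i => v i / u i) (by obtain ⟨i, hi⟩ := hu; exact ⟨i, by simpa using hi⟩)
  have hi' : 0 < u i := by simpa using hi
  refine ⟨v i / u i, fun j => ?_, i, hi', by field_simp⟩
  by_cases hj : 0 < u j
  · have := hmin j (by simpa using hj)
    rw [le_div_iff₀ hj] at this
    linarith
  · have h1 : 0 ≤ v i / u i := div_nonneg (hv i) hi'.le
    nlinarith [hv j, mul_nonneg h1 (sub_nonneg.2 (not_lt.1 hj))]

section Pivoting

variable {ι E : Type*} [Fintype ι] [AddCommGroup E] [Module ℝ E]

/-- `z` is a combination of the points `x i`, `i ∈ S`, with coefficients `w`. -/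
def IsCombination (x : ι → E) (S : Finset ι) (w : ι → ℝ) (z : E) : Prop :=
  (∀ i, 0 ≤ w i) ∧ (∀ i ∉ S, w i = 0) ∧ ∑ i, w i • x i = z

theorem IsCombination.functional_apply {x : ι → E} {S : Finset ι} {w : ι → ℝ} {z : E}
    (h : IsCombination x S w z) (L : E →ₗ[ℝ] ℝ) : L z = ∑ i, w i * L (x i) := by
  rw [← h.2.2]; simp

theorem IsCombination.functional_apply_eq_sum {x : ι → E} {S : Finset ι} {w : ι → ℝ} {z : E}
    (h : IsCombination x S w z) (L : E →ₗ[ℝ] ℝ) (hL : ∀ i ∈ S, L (x i) = 1) :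
    L z = ∑ i, w i := by
  rw [h.functional_apply]
  refine Finset.sum_congr rfl fun i _ => ?_
  by_cases hi : i ∈ S
  · rw [hL i hi, mul_one]
  · rw [h.2.1 i hi, zero_mul]

theorem mem_convexHull_range_iff (x : ι → E) (z : E) :
    z ∈ convexHull ℝ (Set.range x) ↔
      ∃ w : ι → ℝ, (∀ i, 0 ≤ w i) ∧ ∑ i, w i = 1 ∧ ∑ i, w i • x i = z := by
  constructor
  · intro h
    classical
    have : convexHull ℝ (Set.range x) ⊆
        {z | ∃ w : ι → ℝ, (∀ i, 0 ≤ w i) ∧ ∑ i, w i = 1 ∧ ∑ i, w i • x i = z} := by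
      refine convexHull_min ?_ ?_
      · rintro _ ⟨i, rfl⟩
        refine ⟨Pi.single i 1, fun j => ?_, by simp, ?_⟩
        · by_cases h : j = i
          · subst h; simp
          · simp [h]
        · rw [Finset.sum_eq_single i] <;> simp +contextual
      · rintro a ⟨w, hw, hs, rfl⟩ b ⟨w', hw', hs', rfl⟩ s t hs0 ht0 hst
        refine ⟨fun i => s * w i + t * w' i, fun i => ?_, ?_, ?_⟩
        · have := hw i; have := hw' i; positivity
        · rw [Finset.sum_add_distrib, ← Finset.mul_sum, ← Finset.mul_sum, hs, hs']; linarith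
        · simp only [add_smul, mul_smul, Finset.sum_add_distrib, Finset.smul_sum]
    exact this h
  · rintro ⟨w, hw, hs, rfl⟩
    exact (convex_convexHull ℝ _).sum_mem (fun i _ => hw i) hs
      fun i _ => subset_convexHull ℝ _ ⟨i, rfl⟩

/-- Exchange step: a combination supported on `S ∪ {m}` becomes a combination supported on
another set of the same size, along a linear relation `u`. -/
theorem IsCombination.exchange [DecidableEq ι] {x : ι → E} {S T : Finset ι} {w : ι → ℝ} {z : E}
    (h : IsCombination x T w z) {m : ι} (hm : m ∉ S) (hT : T ⊆ insert m S) (u : ι → ℝ)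
    (huS : ∀ i ∉ insert m S, u i = 0) (hu0 : ∑ i, u i • x i = 0) (hu : ∃ i, 0 < u i) :
    ∃ S' : Finset ι, S'.card = S.card ∧ ∃ τ : ℝ,
      IsCombination x S' (fun i => w i - τ * u i) z ∧ ∃ i, 0 < u i ∧ w i = τ * u i := by
  obtain ⟨τ, hτ, i, hi, hiτ⟩ := exists_sub_mul_nonneg w u h.1 hu
  have him : i ∈ insert m S := by
    by_contra hc
    rw [huS i hc] at hi
    exact lt_irrefl _ hi
  refine ⟨(insert m S).erase i, ?_, τ, ⟨hτ, fun j hj => ?_, ?_⟩, i, hi, hiτ⟩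
  · rw [Finset.card_erase_of_mem him, Finset.card_insert_of_notMem hm]; rfl
  · by_cases hji : j = i
    · subst hji; exact sub_eq_zero.2 hiτ
    · have hj' : j ∉ insert m S := fun hc => hj (Finset.mem_erase.2 ⟨hji, hc⟩)
      simp [h.2.1 j fun hc => hj' (hT hc), huS j hj']
  · simp only [sub_smul, mul_smul, Finset.sum_sub_distrib, ← Finset.smul_sum]
    rw [hu0, h.2.2]; simp

theorem exists_isCombination_card {x : ι → E} {k : ℕ} (hk : k ≤ Fintype.card ι)
    (hspan : ∀ S : Finset ι, S.card = k → ∀ z, ∃ w : ι → ℝ,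
      (∀ i ∉ S, w i = 0) ∧ ∑ i, w i • x i = z)
    (z : E) (T : Finset ι) (w : ι → ℝ) (h : IsCombination x T w z) :
    ∃ S : Finset ι, S.card = k ∧ ∃ w', IsCombination x S w' z := by
  classical
  induction T using Finset.induction_on generalizing z w with
  | empty =>
    obtain ⟨S, -, hS⟩ := Finset.exists_subset_card_eq (s := (Finset.univ : Finset ι)) (n := k)
      (by simpa using hk)
    exact ⟨S, hS, w, h.1, fun i _ => h.2.1 i (Finset.notMem_empty i), h.2.2⟩
  | insert m T hm ih =>
    obtain ⟨S, hS, w', hw'⟩ := ih (∑ i, (if i = m then 0 else w i) • x i)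
      (fun i => if i = m then 0 else w i)
      ⟨fun i => by dsimp only; split_ifs; exacts [le_rfl, h.1 i], fun i hi => by
        dsimp only
        split_ifs with him
        · rfl
        · exact h.2.1 i (by simp [him, hi]), rfl⟩
    have hz : ∑ i, (w' i + if i = m then w m else 0) • x i = z := by
      rw [← h.2.2]
      simp only [add_smul, Finset.sum_add_distrib]
      rw [hw'.2.2, ← Finset.sum_add_distrib]
      refine Finset.sum_congr rfl fun i _ => ?_
      by_cases him : i = m
      · subst him; simp
      · simp [him]
    have hcomb : IsCombination x (insert m S) (fun i => w' i + if i = m then w m else 0) z := by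
      refine ⟨fun i => ?_, fun i hi => ?_, hz⟩
      · have := hw'.1 i; have := h.1 m; dsimp only; split_ifs <;> linarith
      · rw [Finset.mem_insert, not_or] at hi
        simp [hi.1, hw'.2.1 i hi.2]
    by_cases hmS : m ∈ S
    · rw [Finset.insert_eq_of_mem hmS] at hcomb
      exact ⟨S, hS, _, hcomb⟩
    · obtain ⟨c, hc, hcm⟩ := hspan S hS (x m)
      obtain ⟨S', hS', τ, hτ, -⟩ := hcomb.exchange hmS subset_rfl
        (fun i => (if i = m then 1 else 0) - c i)
        (fun i hi => by
          rw [Finset.mem_insert, not_or] at hi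
          simp [hi.1, hc i hi.2])
        (by simp [sub_smul, Finset.sum_sub_distrib, hcm])
        ⟨m, by simp [hc m hmS]⟩
      exact ⟨S', hS'.trans hS, _, hτ⟩

/-- The hypotheses of general position on the points `x` and on `z`. -/
structure InGeneralPosition (x : ι → E) (k : ℕ) (L : Finset ι → E →ₗ[ℝ] ℝ) (z : E) : Prop where
  span : ∀ S : Finset ι, S.card = k → ∀ y, ∃ w : ι → ℝ,
    (∀ i ∉ S, w i = 0) ∧ ∑ i, w i • x i = y
  apply_of_mem : ∀ S : Finset ι, S.card = k → ∀ i ∈ S, L S (x i) = 1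
  apply_of_notMem : ∀ S : Finset ι, S.card = k → ∀ i ∉ S, L S (x i) ≠ 1
  coeff_ne_zero : ∀ S : Finset ι, S.card = k → ∀ w, IsCombination x S w z → ∀ i ∈ S, w i ≠ 0
  apply_ne_one : ∀ S : Finset ι, S.card = k → L S z ≠ 1

theorem InGeneralPosition.exists_upper {x : ι → E} {k : ℕ} {L : Finset ι → E →ₗ[ℝ] ℝ} {z : E}
    (G : InGeneralPosition x k L z) (hk : k ≤ Fintype.card ι) {t : ℝ} (ht : 1 ≤ t)
    (hz : t • z ∈ convexHull ℝ (Set.range x)) :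
    ∃ S : Finset ι, S.card = k ∧ (∀ m ∉ S, L S (x m) < 1) ∧
      ∃ w, IsCombination x S w z ∧ ∑ i, w i ≤ 1 := by
  classical
  obtain ⟨v, hv, hv1, hvz⟩ := (mem_convexHull_range_iff x _).1 hz
  have ht0 : 0 < t := by linarith
  have hT : IsCombination x Finset.univ (fun i => t⁻¹ * v i) z := by
    refine ⟨fun i => mul_nonneg (inv_nonneg.2 ht0.le) (hv i), by simp, ?_⟩
    simp only [mul_smul, ← Finset.smul_sum]
    rw [hvz, smul_smul, inv_mul_cancel₀ ht0.ne', one_smul]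
  obtain ⟨S₀, hS₀, w₀, hw₀⟩ := exists_isCombination_card hk G.span z _ _ hT
  obtain ⟨S, hS, hmin⟩ := Finset.exists_min_image
    (Finset.univ.filter fun S : Finset ι => S.card = k ∧ ∃ w, IsCombination x S w z)
    (fun S => L S z) ⟨S₀, by simpa using ⟨hS₀, w₀, hw₀⟩⟩
  simp only [Finset.mem_filter, Finset.mem_univ, true_and] at hS hmin
  obtain ⟨hSk, w, hw⟩ := hS
  have hup : ∀ m ∉ S, L S (x m) < 1 := by
    intro m hm
    refine lt_of_le_of_ne ?_ (G.apply_of_notMem S hSk m hm)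
    by_contra! hgt
    obtain ⟨c, hc, hcm⟩ := G.span S hSk (x m)
    have hLc : L S (x m) = ∑ i, c i := by
      rw [← hcm]
      simp only [map_sum, map_smul, smul_eq_mul]
      refine Finset.sum_congr rfl fun i _ => ?_
      by_cases hi : i ∈ S
      · rw [G.apply_of_mem S hSk i hi, mul_one]
      · rw [hc i hi, zero_mul]
    have hsum : ∑ i, (c i - if i = m then 1 else 0) = L S (x m) - 1 := by
      rw [Finset.sum_sub_distrib, hLc]; simp
    obtain ⟨j, -, hj⟩ : ∃ j ∈ Finset.univ, 0 < c j - if j = m then 1 else 0 := by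
      apply Finset.exists_lt_of_sum_lt
      simp only [Finset.sum_const_zero]
      linarith
    obtain ⟨S', hS', τ, hτ, i, hi, hiτ⟩ := hw.exchange hm (Finset.subset_insert m S)
        (fun i => c i - if i = m then 1 else 0)
        (fun i hi => by
          rw [Finset.mem_insert, not_or] at hi
          simp [hi.1, hc i hi.2])
        (by simp [sub_smul, Finset.sum_sub_distrib, hcm]) ⟨j, hj⟩
    have hiS : i ∈ S := by
      by_contra hiS
      rw [hc i hiS] at hi
      split_ifs at hi <;> linarith
    have hwi : 0 < w i := lt_of_le_of_ne (hw.1 i) (G.coeff_ne_zero S hSk w hw i hiS).symm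
    have hτ0 : 0 < τ := by
      rw [hiτ] at hwi
      exact pos_of_mul_pos_left hwi hi.le
    have h1 := hmin S' ⟨hS'.trans hSk, _, hτ⟩
    rw [hτ.functional_apply_eq_sum _ (G.apply_of_mem S' (hS'.trans hSk)),
      hw.functional_apply_eq_sum _ (G.apply_of_mem S hSk), Finset.sum_sub_distrib,
      ← Finset.mul_sum, hsum] at h1
    nlinarith
  refine ⟨S, hSk, hup, w, hw, ?_⟩
  rw [← hw.functional_apply_eq_sum _ (G.apply_of_mem S hSk), hT.functional_apply]
  calc ∑ i, t⁻¹ * v i * L S (x i) ≤ ∑ i, t⁻¹ * v i * 1 := by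
        refine Finset.sum_le_sum fun i _ => mul_le_mul_of_nonneg_left ?_
          (mul_nonneg (inv_nonneg.2 ht0.le) (hv i))
        by_cases hi : i ∈ S
        · exact (G.apply_of_mem S hSk i hi).le
        · exact (hup i hi).le
    _ = t⁻¹ := by simp only [mul_one, ← Finset.mul_sum, hv1]
    _ ≤ 1 := inv_le_one_of_one_le₀ ht

theorem smul_mem_convexHull_of_isCombination {x : ι → E} {S : Finset ι} {w : ι → ℝ} {z : E}
    (hw : IsCombination x S w z) (h0 : 0 < ∑ i, w i) :
    (∑ i, w i)⁻¹ • z ∈ convexHull ℝ (Set.range x) := by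
  rw [mem_convexHull_range_iff]
  refine ⟨fun i => (∑ i, w i)⁻¹ * w i, fun i => mul_nonneg (inv_nonneg.2 h0.le) (hw.1 i), ?_, ?_⟩
  · rw [← Finset.mul_sum, inv_mul_cancel₀ h0.ne']
  · simp only [mul_smul, ← Finset.smul_sum, hw.2.2]

theorem InGeneralPosition.exists_lower {x : ι → E} {k : ℕ} {L : Finset ι → E →ₗ[ℝ] ℝ} {z : E}
    (G : InGeneralPosition x k L z) (hk : k ≤ Fintype.card ι) {t : ℝ} (ht : 1 ≤ t)
    (hz : t • z ∈ convexHull ℝ (Set.range x)) (hzP : z ∉ convexHull ℝ (Set.range x)) :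
    ∃ S : Finset ι, S.card = k ∧ (∀ m ∉ S, 1 < L S (x m)) ∧
      ∃ w, IsCombination x S w z ∧ ∑ i, w i ≤ 1 := by
  classical
  obtain ⟨v, hv, hv1, hvz⟩ := (mem_convexHull_range_iff x _).1 hz
  have ht0 : 0 < t := by linarith
  have hT : IsCombination x Finset.univ (fun i => t⁻¹ * v i) z := by
    refine ⟨fun i => mul_nonneg (inv_nonneg.2 ht0.le) (hv i), by simp, ?_⟩
    simp only [mul_smul, ← Finset.smul_sum]
    rw [hvz, smul_smul, inv_mul_cancel₀ ht0.ne', one_smul]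
  have hbetween : ∀ s : ℝ, s ≤ 1 → s • z ∉ convexHull ℝ (Set.range x) := by
    intro s hs hsz
    apply hzP
    rcases ht.eq_or_lt with rfl | ht1
    · simpa using hz
    have := (convex_convexHull ℝ (Set.range x)) hsz hz
      (a := (t - 1) / (t - s)) (b := (1 - s) / (t - s))
      (div_nonneg (by linarith) (by linarith)) (div_nonneg (by linarith) (by linarith))
      (by rw [← add_div, div_eq_one_iff_eq (by linarith)]; ring)
    rw [smul_smul, smul_smul, ← add_smul] at this
    have hts : t - s ≠ 0 := by linarith
    convert this
    rw [show (t - 1) / (t - s) * s + (1 - s) / (t - s) * t = 1 by field_simp; ring, one_smul]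
  obtain ⟨S₀, hS₀, w₀, hw₀⟩ := exists_isCombination_card hk G.span z _ _ hT
  obtain ⟨S, hS, hmax⟩ := Finset.exists_max_image
    (Finset.univ.filter fun S : Finset ι => S.card = k ∧ ∃ w, IsCombination x S w z)
    (fun S => L S z) ⟨S₀, by simpa using ⟨hS₀, w₀, hw₀⟩⟩
  simp only [Finset.mem_filter, Finset.mem_univ, true_and] at hS hmax
  obtain ⟨hSk, w, hw⟩ := hS
  have hlow : ∀ m ∉ S, 1 < L S (x m) := by
    intro m hm
    refine lt_of_le_of_ne ?_ (G.apply_of_notMem S hSk m hm).symm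
    by_contra! hgt
    obtain ⟨c, hc, hcm⟩ := G.span S hSk (x m)
    have hLc : L S (x m) = ∑ i, c i := by
      rw [← hcm]
      simp only [map_sum, map_smul, smul_eq_mul]
      refine Finset.sum_congr rfl fun i _ => ?_
      by_cases hi : i ∈ S
      · rw [G.apply_of_mem S hSk i hi, mul_one]
      · rw [hc i hi, zero_mul]
    have hsum : ∑ i, (c i - if i = m then 1 else 0) = L S (x m) - 1 := by
      rw [Finset.sum_sub_distrib, hLc]; simp
    have hu0 : ∑ i, (c i - if i = m then 1 else 0) • x i = 0 := by
      simp [sub_smul, Finset.sum_sub_distrib, hcm]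
    obtain ⟨j, hj⟩ : ∃ j, 0 < c j - if j = m then 1 else 0 := by
      by_contra! hneg
      have hcomb : IsCombination x Finset.univ (fun i => -(c i - if i = m then 1 else 0)) 0 := by
        refine ⟨fun i => by linarith [hneg i], by simp, ?_⟩
        simp only [neg_smul, Finset.sum_neg_distrib]
        rw [hu0, neg_zero]
      have h0 := smul_mem_convexHull_of_isCombination hcomb (by
        rw [Finset.sum_neg_distrib, hsum]; linarith)
      apply hbetween 0 zero_le_one
      rwa [zero_smul, ← smul_zero (∑ i, -(c i - if i = m then 1 else 0))⁻¹]
    obtain ⟨S', hS', τ, hτ, i, hi, hiτ⟩ := hw.exchange hm (Finset.subset_insert m S)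
        (fun i => c i - if i = m then 1 else 0)
        (fun i hi => by
          rw [Finset.mem_insert, not_or] at hi
          simp [hi.1, hc i hi.2]) hu0 ⟨j, hj⟩
    have hiS : i ∈ S := by
      by_contra hiS
      rw [hc i hiS] at hi
      split_ifs at hi <;> linarith
    have hwi : 0 < w i := lt_of_le_of_ne (hw.1 i) (G.coeff_ne_zero S hSk w hw i hiS).symm
    have hτ0 : 0 < τ := by
      rw [hiτ] at hwi
      exact pos_of_mul_pos_left hwi hi.le
    have h1 := hmax S' ⟨hS'.trans hSk, _, hτ⟩
    rw [hτ.functional_apply_eq_sum _ (G.apply_of_mem S' (hS'.trans hSk)),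
      hw.functional_apply_eq_sum _ (G.apply_of_mem S hSk), Finset.sum_sub_distrib,
      ← Finset.mul_sum, hsum] at h1
    nlinarith
  refine ⟨S, hSk, hlow, w, hw, ?_⟩
  by_contra! hgt
  exact hbetween _ (inv_le_one_of_one_le₀ hgt.le)
    (smul_mem_convexHull_of_isCombination hw (by linarith))

theorem InGeneralPosition.sum_pos {x : ι → E} {k : ℕ} {L : Finset ι → E →ₗ[ℝ] ℝ} {z : E}
    (G : InGeneralPosition x k L z) (hk0 : 0 < k) {S : Finset ι} (hS : S.card = k) {w : ι → ℝ}
    (hw : IsCombination x S w z) : 0 < ∑ i, w i := by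
  obtain ⟨i, hi⟩ := Finset.card_pos.1 (hS ▸ hk0)
  exact Finset.sum_pos' (fun i _ => hw.1 i) ⟨i, Finset.mem_univ i,
    lt_of_le_of_ne (hw.1 i) (G.coeff_ne_zero S hS w hw i hi).symm⟩

theorem InGeneralPosition.exists_smul_mem {x : ι → E} {k : ℕ} {L : Finset ι → E →ₗ[ℝ] ℝ} {z : E}
    (G : InGeneralPosition x k L z) (hk0 : 0 < k) {S : Finset ι} (hS : S.card = k) {w : ι → ℝ}
    (hw : IsCombination x S w z) (h1 : ∑ i, w i ≤ 1) :
    ∃ t : ℝ, 1 ≤ t ∧ t • z ∈ convexHull ℝ (Set.range x) :=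
  ⟨_, (one_le_inv₀ (G.sum_pos hk0 hS hw)).2 h1,
    smul_mem_convexHull_of_isCombination hw (G.sum_pos hk0 hS hw)⟩

theorem InGeneralPosition.notMem_of_lower {x : ι → E} {k : ℕ} {L : Finset ι → E →ₗ[ℝ] ℝ} {z : E}
    (G : InGeneralPosition x k L z) {S : Finset ι} (hS : S.card = k)
    (hlow : ∀ m ∉ S, 1 < L S (x m)) {w : ι → ℝ}
    (hw : IsCombination x S w z) (h1 : ∑ i, w i ≤ 1) : z ∉ convexHull ℝ (Set.range x) := by
  intro hz
  obtain ⟨v, hv, hv1, hvz⟩ := (mem_convexHull_range_iff x _).1 hz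
  have hge : 1 ≤ L S z := by
    rw [← hvz, ← hv1]
    simp only [map_sum, map_smul, smul_eq_mul]
    refine Finset.sum_le_sum fun i _ => le_mul_of_one_le_right (hv i) ?_
    by_cases hi : i ∈ S
    · exact (G.apply_of_mem S hS i hi).ge
    · exact (hlow i hi).le
  rw [← hw.functional_apply_eq_sum _ (G.apply_of_mem S hS)] at h1
  exact G.apply_ne_one S hS (le_antisymm h1 hge)

/-- Two different supporting sets cannot both support a combination equal to `z`. -/
theorem InGeneralPosition.eq_of_sign {x : ι → E} {k : ℕ} {L : Finset ι → E →ₗ[ℝ] ℝ} {z : E}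
    (G : InGeneralPosition x k L z) (ε : ℝ) {S T : Finset ι} (hS : S.card = k) (hT : T.card = k)
    (hS' : ∀ m ∉ S, ε * L S (x m) < ε) (hT' : ∀ m ∉ T, ε * L T (x m) < ε)
    {w v : ι → ℝ} (hw : IsCombination x S w z) (hv : IsCombination x T v z) : S = T := by
  have key : ∀ {S T : Finset ι}, S.card = k → T.card = k → S ≠ T →
      (∀ m ∉ S, ε * L S (x m) < ε) → ∀ {w v : ι → ℝ}, IsCombination x S w z →
      IsCombination x T v z → ε * ∑ i, w i < ε * ∑ i, v i := by
    intro S T hS hT hne hS' w v hw hv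
    rw [← hw.functional_apply_eq_sum _ (G.apply_of_mem S hS), hv.functional_apply,
      Finset.mul_sum, Finset.mul_sum]
    obtain ⟨i, hiT, hiS⟩ : ∃ i ∈ T, i ∉ S := by
      by_contra! hsub
      exact hne (Finset.eq_of_subset_of_card_le hsub (by rw [hS, hT])).symm
    refine Finset.sum_lt_sum (fun j _ => ?_) ⟨i, Finset.mem_univ i, ?_⟩
    · by_cases hj : j ∈ S
      · rw [G.apply_of_mem S hS j hj, mul_one]
      · nlinarith [hS' j hj, hv.1 j]
    · have : 0 < v i := lt_of_le_of_ne (hv.1 i) (G.coeff_ne_zero T hT v hv i hiT).symm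
      nlinarith [hS' i hiS]
  by_contra hne
  exact lt_asymm (key hS hT hne hS' hw hv) (key hT hS (Ne.symm hne) hT' hv hw)

theorem sum_ite_one_of_unique {α : Type*} (s : Finset α) (p : α → Prop) [DecidablePred p]
    (h : ∀ a ∈ s, ∀ b ∈ s, p a → p b → a = b) [Decidable (∃ a ∈ s, p a)] :
    ∑ a ∈ s, (if p a then (1 : ENNReal) else 0) = if ∃ a ∈ s, p a then 1 else 0 := by
  split_ifs with hex
  · obtain ⟨a, ha, hpa⟩ := hex
    rw [Finset.sum_eq_single_of_mem a ha fun b hb hba =>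
        if_neg fun hpb => hba (h b hb a ha hpb hpa),
      if_pos hpa]
  · exact Finset.sum_eq_zero fun a ha => if_neg fun hpa => hex ⟨a, ha, hpa⟩

open Classical in
/-- Signed decomposition of the indicator of a polytope into the cones over its facets. -/
theorem InGeneralPosition.indicator_convexHull {x : ι → E} {k : ℕ} {L : Finset ι → E →ₗ[ℝ] ℝ}
    {z : E} (G : InGeneralPosition x k L z) (hk : k ≤ Fintype.card ι) (hk0 : 0 < k) :
    (if z ∈ convexHull ℝ (Set.range x) then (1 : ENNReal) else 0) +
      ∑ S ∈ Finset.powersetCard k Finset.univ, (if (∀ m ∉ S, 1 < L S (x m)) ∧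
        ∃ w, IsCombination x S w z ∧ ∑ i, w i ≤ 1 then 1 else 0) =
      ∑ S ∈ Finset.powersetCard k Finset.univ, (if (∀ m ∉ S, L S (x m) < 1) ∧
        ∃ w, IsCombination x S w z ∧ ∑ i, w i ≤ 1 then 1 else 0) := by
  rw [sum_ite_one_of_unique, sum_ite_one_of_unique]
  · simp only [Finset.mem_powersetCard_univ]
    by_cases hA : ∃ t : ℝ, 1 ≤ t ∧ t • z ∈ convexHull ℝ (Set.range x)
    · obtain ⟨t, ht, htz⟩ := hA
      have hup := G.exists_upper hk ht htz
      by_cases hz : z ∈ convexHull ℝ (Set.range x)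
      · rw [if_pos hz, if_neg, add_zero, if_pos hup]
        rintro ⟨S, hS, hlow, w, hw, h1⟩
        exact G.notMem_of_lower hS hlow hw h1 hz
      · have hlow := G.exists_lower hk ht htz hz
        rw [if_neg hz, zero_add, if_pos hlow, if_pos hup]
    · rw [if_neg, if_neg, if_neg, add_zero]
      · rintro ⟨S, hS, -, w, hw, h1⟩
        exact hA (G.exists_smul_mem hk0 hS hw h1)
      · rintro ⟨S, hS, -, w, hw, h1⟩
        exact hA (G.exists_smul_mem hk0 hS hw h1)
      · intro hz
        exact hA ⟨1, le_rfl, by simpa using hz⟩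
  · rintro S hS T hT ⟨hS', w, hw, -⟩ ⟨hT', v, hv, -⟩
    exact G.eq_of_sign 1 (by simpa using hS) (by simpa using hT) (by simpa using hS')
      (by simpa using hT') hw hv
  · rintro S hS T hT ⟨hS', w, hw, -⟩ ⟨hT', v, hv, -⟩
    exact G.eq_of_sign (-1) (by simpa using hS) (by simpa using hT) (by simpa using hS')
      (by simpa using hT') hw hv

end Pivoting

/-- The determinant of three vectors of `ℝ³`. -/
noncomputable def det3 (a b c : EuclideanSpace ℝ (Fin 3)) : ℝ :=
  a 0 * (b 1 * c 2 - b 2 * c 1) - a 1 * (b 0 * c 2 - b 2 * c 0) + a 2 * (b 0 * c 1 - b 1 * c 0)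

/-- The cross product on Euclidean space. -/
noncomputable def crossVec (b c : EuclideanSpace ℝ (Fin 3)) : EuclideanSpace ℝ (Fin 3) :=
  !₂[b 1 * c 2 - b 2 * c 1, b 2 * c 0 - b 0 * c 2, b 0 * c 1 - b 1 * c 0]

/-- A normal vector of the plane through three points. -/
noncomputable def planeNormal (a b c : EuclideanSpace ℝ (Fin 3)) : EuclideanSpace ℝ (Fin 3) :=
  crossVec a b + crossVec b c + crossVec c a

theorem inner_fin_three (a b : EuclideanSpace ℝ (Fin 3)) :
    inner ℝ a b = a 0 * b 0 + a 1 * b 1 + a 2 * b 2 := by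
  simp [PiLp.inner_apply, Fin.sum_univ_three]; ring

theorem inner_crossVec (a b c : EuclideanSpace ℝ (Fin 3)) :
    inner ℝ (crossVec b c) a = det3 a b c := by
  rw [inner_fin_three]; simp [crossVec, det3]; ring

theorem det3_rotate (a b c : EuclideanSpace ℝ (Fin 3)) : det3 b c a = det3 a b c := by
  simp only [det3]; ring

theorem inner_planeNormal (a b c x : EuclideanSpace ℝ (Fin 3)) :
    inner ℝ (planeNormal a b c) x = det3 x b c + det3 a x c + det3 a b x := by
  rw [planeNormal, inner_add_left, inner_add_left, inner_crossVec, inner_crossVec, inner_crossVec]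
  simp only [det3]; ring

theorem inner_planeNormal_left (a b c : EuclideanSpace ℝ (Fin 3)) :
    inner ℝ (planeNormal a b c) a = det3 a b c := by
  rw [inner_planeNormal]; simp only [det3]; ring

theorem inner_planeNormal_mid (a b c : EuclideanSpace ℝ (Fin 3)) :
    inner ℝ (planeNormal a b c) b = det3 a b c := by
  rw [inner_planeNormal]; simp only [det3]; ring

theorem inner_planeNormal_right (a b c : EuclideanSpace ℝ (Fin 3)) :
    inner ℝ (planeNormal a b c) c = det3 a b c := by
  rw [inner_planeNormal]; simp only [det3]; ring

/-- The Cramer formula for three equations. -/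
theorem det3_smul_eq (a b c z : EuclideanSpace ℝ (Fin 3)) :
    det3 a b c • z = det3 z b c • a + det3 a z c • b + det3 a b z • c := by
  ext i
  fin_cases i <;> simp [det3] <;> ring

theorem crossVec_ne_zero {a b c : EuclideanSpace ℝ (Fin 3)} (h : det3 a b c ≠ 0) :
    crossVec b c ≠ 0 := by
  intro h0
  rw [← inner_crossVec, h0, inner_zero_left] at h
  exact h rfl

theorem planeNormal_ne_zero {a b c : EuclideanSpace ℝ (Fin 3)} (h : det3 a b c ≠ 0) :
    planeNormal a b c ≠ 0 := by
  intro h0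
  rw [← inner_planeNormal_left, h0, inner_zero_left] at h
  exact h rfl

/-- The linear functional equal to `1` at three given linearly independent vectors. -/
noncomputable def planeFunctional (a b c : EuclideanSpace ℝ (Fin 3)) :
    EuclideanSpace ℝ (Fin 3) →ₗ[ℝ] ℝ :=
  (det3 a b c)⁻¹ • (innerSL ℝ (planeNormal a b c)).toLinearMap

theorem planeFunctional_apply (a b c x : EuclideanSpace ℝ (Fin 3)) :
    planeFunctional a b c x = (det3 a b c)⁻¹ * inner ℝ (planeNormal a b c) x := by
  simp [planeFunctional]

/-- `μ` gives no mass to affine planes. -/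
def NullOnPlanes (μ : Measure (EuclideanSpace ℝ (Fin 3))) : Prop :=
  ∀ p : EuclideanSpace ℝ (Fin 3), p ≠ 0 → ∀ c : ℝ, μ {z | inner ℝ p z = c} = 0

theorem nullOnPlanes_volume : NullOnPlanes volume := by
  intro p hp c
  have h0 : volume {z : EuclideanSpace ℝ (Fin 3) | inner ℝ p z = 0} = 0 := by
    have : {z : EuclideanSpace ℝ (Fin 3) | inner ℝ p z = 0} =
        ((innerSL ℝ p).toLinearMap.ker : Set (EuclideanSpace ℝ (Fin 3))) := by
      ext z; simp
    rw [this]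
    refine Measure.addHaar_submodule _ _ fun htop => hp ?_
    have : p ∈ (innerSL ℝ p).toLinearMap.ker := htop ▸ Submodule.mem_top
    simpa using this
  have hpp : inner ℝ p p ≠ 0 := by simpa using hp
  have : {z : EuclideanSpace ℝ (Fin 3) | inner ℝ p z = c} =
      (fun z => (-(c / inner ℝ p p)) • p + z) ⁻¹' {z | inner ℝ p z = 0} := by
    ext z
    simp only [Set.mem_ofPred_eq, Set.mem_preimage, inner_add_right, inner_smul_right]
    rw [neg_mul, div_mul_cancel₀ _ hpp]
    constructor <;> intro h <;> linarith
  rw [this, measure_preimage_add, h0]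

theorem NullOnPlanes.ae_ne {μ : Measure (EuclideanSpace ℝ (Fin 3))} (h : NullOnPlanes μ)
    {p : EuclideanSpace ℝ (Fin 3)} (hp : p ≠ 0) (c : ℝ) : ∀ᵐ z ∂μ, inner ℝ p z ≠ c := by
  rw [ae_iff]; simpa using h p hp c

theorem lintegral_pi_fin_succ {α : Type*} [MeasurableSpace α] (μ : Measure α) [SigmaFinite μ]
    {n : ℕ} (f : (Fin (n + 1) → α) → ENNReal) (hf : Measurable f) :
    ∫⁻ x, f x ∂(Measure.pi fun _ => μ) =
      ∫⁻ a, ∫⁻ y, f (Fin.cons a y) ∂(Measure.pi fun _ : Fin n => μ) ∂μ := by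
  have h := (measurePreserving_piFinSuccAbove (fun _ : Fin (n + 1) => μ) 0).symm
  rw [← h.lintegral_comp_emb (MeasurableEquiv.measurableEmbedding _), lintegral_prod]
  · refine lintegral_congr fun a => lintegral_congr fun y => congrArg f ?_
    simp [MeasurableEquiv.piFinSuccAbove, Fin.insertNthEquiv]
  · exact (hf.comp (MeasurableEquiv.measurable _)).aemeasurable

theorem lintegral_pi_fin_three {α : Type*} [MeasurableSpace α] (μ : Measure α) [SigmaFinite μ]
    (f : (Fin 3 → α) → ENNReal) (hf : Measurable f) :
    ∫⁻ x, f x ∂(Measure.pi fun _ => μ) = ∫⁻ a, ∫⁻ b, ∫⁻ c, f ![a, b, c] ∂μ ∂μ ∂μ := by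
  have hc : ∀ {n : ℕ} (a : α), Measurable fun y : Fin n → α =>
      (Fin.cons a y : Fin (n + 1) → α) := by
    intro n a
    refine measurable_pi_iff.2 fun i => ?_
    refine Fin.cases ?_ (fun j => ?_) i
    · simp
    · simpa using measurable_pi_apply j
  rw [lintegral_pi_fin_succ μ f hf]
  refine lintegral_congr fun a => ?_
  rw [lintegral_pi_fin_succ μ (fun y => f (Fin.cons a y)) (hf.comp (hc a))]
  refine lintegral_congr fun b => ?_
  rw [lintegral_pi_fin_succ μ (fun y => f (Fin.cons a (Fin.cons b y)))
    ((hf.comp (hc a)).comp (hc b))]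
  refine lintegral_congr fun c => ?_
  rw [lintegral_unique]
  simp only [Measure.pi_empty_univ, mul_one]
  congr 1

theorem lintegral_max_sub_pow (k : ℕ) (hk : 0 < k) (r : ℝ) :
    ∫⁻ y, (if 0 ≤ y then ENNReal.ofReal (max (r - y) 0 ^ k) else 0) =
      ENNReal.ofReal (max r 0 ^ (k + 1) / (k + 1)) := by
  have h1 : ∀ y : ℝ, (if 0 ≤ y then ENNReal.ofReal (max (r - y) 0 ^ k) else 0) =
      (Set.Icc 0 (max r 0)).indicator (fun y => ENNReal.ofReal ((max r 0 - y) ^ k)) y := by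
    intro y
    by_cases hy : 0 ≤ y
    · rw [if_pos hy]
      rcases le_total r 0 with hr | hr
      · rw [max_eq_right hr, max_eq_right (by linarith), zero_pow hk.ne']
        by_cases h : y ∈ Set.Icc (0 : ℝ) 0
        · rw [Set.indicator_of_mem h]
          have : y = 0 := le_antisymm h.2 h.1
          simp [this, hk.ne']
        · rw [Set.indicator_of_notMem h]; simp
      · rw [max_eq_left hr]
        by_cases h : y ≤ r
        · rw [Set.indicator_of_mem (Set.mem_Icc.2 ⟨hy, h⟩), max_eq_left (by linarith)]
        · rw [Set.indicator_of_notMem (fun hc => h hc.2), max_eq_right (by linarith),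
            zero_pow hk.ne', ENNReal.ofReal_zero]
    · rw [if_neg hy, Set.indicator_of_notMem fun hc => hy hc.1]
  simp_rw [h1]
  rw [lintegral_indicator measurableSet_Icc, ← ofReal_integral_eq_lintegral_ofReal]
  · congr 1
    rw [integral_Icc_eq_integral_Ioc, ← intervalIntegral.integral_of_le (le_max_right _ _)]
    rw [intervalIntegral.integral_comp_sub_left (fun y => y ^ k)]
    simp
  · exact (Continuous.integrableOn_Icc (by fun_prop))
  · filter_upwards [ae_restrict_mem measurableSet_Icc] with y hy
    exact pow_nonneg (sub_nonneg.2 hy.2) k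

/-- The solid corner simplex. -/
def cornerSimplex : Set (Fin 3 → ℝ) := {t | (∀ i, 0 ≤ t i) ∧ ∑ i, t i ≤ 1}

theorem isCompact_cornerSimplex : IsCompact cornerSimplex := by
  refine (isCompact_Icc (a := (0 : Fin 3 → ℝ)) (b := 1)).of_isClosed_subset ?_ ?_
  · have : cornerSimplex = (⋂ i, {t : Fin 3 → ℝ | 0 ≤ t i}) ∩ {t | ∑ i, t i ≤ 1} := by
      ext t; simp [cornerSimplex]
    rw [this]
    exact (isClosed_iInter fun i => isClosed_le continuous_const (continuous_apply i)).inter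
      (isClosed_le (by fun_prop) continuous_const)
  · rintro t ⟨h0, h1⟩
    refine ⟨h0, fun i => ?_⟩
    exact (Finset.single_le_sum (fun j _ => h0 j) (Finset.mem_univ i)).trans h1

theorem volume_cornerSimplex : volume cornerSimplex = ENNReal.ofReal (1 / 6) := by
  rw [← lintegral_indicator_one isCompact_cornerSimplex.measurableSet, volume_pi,
    lintegral_pi_fin_three _ _ (measurable_one.indicator isCompact_cornerSimplex.measurableSet)]
  have h1 : ∀ a b : ℝ, ∫⁻ c : ℝ, cornerSimplex.indicator (1 : (Fin 3 → ℝ) → ENNReal) ![a, b, c] =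
      if 0 ≤ a then if 0 ≤ b then ENNReal.ofReal (max (1 - a - b) 0 ^ 1) else 0 else 0 := by
    intro a b
    by_cases ha : 0 ≤ a
    · by_cases hb : 0 ≤ b
      · have : ∀ c : ℝ, cornerSimplex.indicator (1 : (Fin 3 → ℝ) → ENNReal) ![a, b, c] =
            (Set.Icc 0 (1 - a - b)).indicator 1 c := by
          intro c
          have : ![a, b, c] ∈ cornerSimplex ↔ c ∈ Set.Icc 0 (1 - a - b) := by
            simp only [cornerSimplex, Set.mem_ofPred_eq, Fin.forall_fin_succ, Fin.sum_univ_three]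
            simp [ha, hb]
            intro _
            constructor <;> intro h <;> linarith
          by_cases h : c ∈ Set.Icc 0 (1 - a - b)
          · rw [Set.indicator_of_mem h, Set.indicator_of_mem (this.2 h)]; rfl
          · rw [Set.indicator_of_notMem h, Set.indicator_of_notMem (mt this.1 h)]
        simp_rw [this]
        rw [lintegral_indicator_one measurableSet_Icc, if_pos ha, if_pos hb, Real.volume_Icc,
          pow_one, sub_zero]
        rcases le_total (1 - a - b) 0 with h | h
        · rw [max_eq_right h, ENNReal.ofReal_of_nonpos h, ENNReal.ofReal_zero]
        · rw [max_eq_left h]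
      · rw [if_pos ha, if_neg hb, lintegral_eq_zero_iff' (by
          exact (measurable_one.indicator isCompact_cornerSimplex.measurableSet).comp
            (by fun_prop) |>.aemeasurable)]
        refine Filter.Eventually.of_forall fun c => Set.indicator_of_notMem ?_ _
        exact fun h => hb (h.1 1)
    · rw [if_neg ha, lintegral_eq_zero_iff' (by
          exact (measurable_one.indicator isCompact_cornerSimplex.measurableSet).comp
            (by fun_prop) |>.aemeasurable)]
      refine Filter.Eventually.of_forall fun c => Set.indicator_of_notMem ?_ _
      exact fun h => ha (h.1 0)
  simp_rw [h1]
  have h2 : ∀ a : ℝ, ∫⁻ b : ℝ, (if 0 ≤ a then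
      if 0 ≤ b then ENNReal.ofReal (max (1 - a - b) 0 ^ 1) else 0 else 0) =
      ENNReal.ofReal (1 / 2) * (if 0 ≤ a then ENNReal.ofReal (max (1 - a) 0 ^ 2) else 0) := by
    intro a
    by_cases ha : 0 ≤ a
    · simp only [if_pos ha]
      rw [lintegral_max_sub_pow 1 one_pos, ← ENNReal.ofReal_mul (by norm_num)]
      congr 1
      norm_num
      ring
    · simp [ha]
  simp_rw [h2]
  rw [lintegral_const_mul' _ _ ENNReal.ofReal_ne_top, lintegral_max_sub_pow 2 two_pos,
    ← ENNReal.ofReal_mul (by norm_num)]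
  norm_num

/-- The simplex spanned by the origin and three vectors. -/
def cone3 (a b c : EuclideanSpace ℝ (Fin 3)) : Set (EuclideanSpace ℝ (Fin 3)) :=
  (fun t : Fin 3 → ℝ => t 0 • a + t 1 • b + t 2 • c) '' cornerSimplex

theorem isCompact_cone3 (a b c : EuclideanSpace ℝ (Fin 3)) : IsCompact (cone3 a b c) :=
  isCompact_cornerSimplex.image (by fun_prop)

theorem volume_cone3 (a b c : EuclideanSpace ℝ (Fin 3)) :
    volume (cone3 a b c) = ENNReal.ofReal (|det3 a b c| / 6) := by
  let M : Matrix (Fin 3) (Fin 3) ℝ := Matrix.of fun i j => ![a i, b i, c i] j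
  have h := EuclideanSpace.volume_preserving_symm_measurableEquiv_toLp (Fin 3)
  have h1 : cone3 a b c =
      (MeasurableEquiv.toLp 2 (Fin 3 → ℝ)).symm ⁻¹' (Matrix.toLin' M '' cornerSimplex) := by
    rw [← MeasurableEquiv.image_eq_preimage_symm, Set.image_image]
    unfold cone3
    refine Set.image_congr fun t _ => ?_
    ext i
    simp [M, Matrix.mulVec, dotProduct, Fin.sum_univ_three]
    ring
  rw [h1, h.measure_preimage_equiv, Measure.addHaar_image_linearMap, LinearMap.det_toLin',
    volume_cornerSimplex, ← ENNReal.ofReal_mul (abs_nonneg _)]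
  congr 1
  have : M.det = det3 a b c := by
    rw [Matrix.det_fin_three]
    simp [M, det3]
    ring
  rw [this]; ring

section Decomposition

variable {ι : Type*}

/-- `e` enumerates each three-element set of indices. -/
def IsEnumeration (e : Finset ι → Fin 3 → ι) : Prop :=
  ∀ S : Finset ι, S.card = 3 → Function.Injective (e S) ∧ ∀ i, i ∈ S ↔ ∃ k, e S k = i

theorem exists_isEnumeration [LinearOrder ι] [Nonempty ι] :
    ∃ e : Finset ι → Fin 3 → ι, IsEnumeration e := by
  classical
  refine ⟨fun S => if h : S.card = 3 then S.orderEmbOfFin h else fun _ => Classical.arbitrary ι,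
    fun S hS => ?_⟩
  simp only [dif_pos hS]
  refine ⟨(S.orderEmbOfFin hS).injective, fun i => ?_⟩
  rw [← Finset.mem_coe, ← Finset.range_orderEmbOfFin S hS, Set.mem_range]

theorem IsEnumeration.exists_extend {e : Finset ι → Fin 3 → ι} (he : IsEnumeration e)
    {S : Finset ι} (hS : S.card = 3) (t : Fin 3 → ℝ) :
    ∃ w : ι → ℝ, (∀ i ∉ S, w i = 0) ∧ ∀ k, w (e S k) = t k := by
  refine ⟨Function.extend (e S) t 0, fun i hi => ?_, fun k => (he S hS).1.extend_apply t 0 k⟩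
  rw [Function.extend_apply' _ _ _ fun h => hi (((he S hS).2 i).2 h)]
  rfl

variable [Fintype ι]

theorem IsEnumeration.sum_eq {e : Finset ι → Fin 3 → ι} (he : IsEnumeration e) {S : Finset ι}
    (hS : S.card = 3) {M : Type*} [AddCommMonoid M] (f : ι → M) (hf : ∀ i ∉ S, f i = 0) :
    ∑ i, f i = f (e S 0) + f (e S 1) + f (e S 2) := by
  classical
  have hS' : S = Finset.univ.image (e S) := by
    ext i
    simp [(he S hS).2 i]
  rw [← Fin.sum_univ_three (fun k => f (e S k)), ← Finset.sum_image (f := f)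
    fun a _ b _ h => (he S hS).1 h, ← hS']
  exact (Finset.sum_subset (Finset.subset_univ S) fun i _ hi => hf i hi).symm

/-- The functional attached to a three-element set of indices. -/
noncomputable def faceFunctional (e : Finset ι → Fin 3 → ι) (X : ι → EuclideanSpace ℝ (Fin 3))
    (S : Finset ι) : EuclideanSpace ℝ (Fin 3) →ₗ[ℝ] ℝ :=
  planeFunctional (X (e S 0)) (X (e S 1)) (X (e S 2))

theorem IsEnumeration.exists_isCombination_iff {e : Finset ι → Fin 3 → ι} (he : IsEnumeration e)
    (X : ι → EuclideanSpace ℝ (Fin 3)) {S : Finset ι} (hS : S.card = 3)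
    (z : EuclideanSpace ℝ (Fin 3)) :
    (∃ w, IsCombination X S w z ∧ ∑ i, w i ≤ 1) ↔
      z ∈ cone3 (X (e S 0)) (X (e S 1)) (X (e S 2)) := by
  constructor
  · rintro ⟨w, ⟨h0, hS0, rfl⟩, h1⟩
    refine ⟨fun k => w (e S k), ⟨fun k => h0 _, ?_⟩, ?_⟩
    · rwa [Fin.sum_univ_three, ← he.sum_eq hS w hS0]
    · rw [he.sum_eq hS (fun i => w i • X i) fun i hi => by rw [hS0 i hi, zero_smul]]
  · rintro ⟨t, ⟨h0, h1⟩, rfl⟩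
    obtain ⟨w, hw0, hwt⟩ := he.exists_extend hS t
    refine ⟨w, ⟨fun i => ?_, hw0, ?_⟩, ?_⟩
    · by_cases hi : i ∈ S
      · obtain ⟨k, rfl⟩ := ((he S hS).2 i).1 hi
        rw [hwt]; exact h0 k
      · rw [hw0 i hi]
    · rw [he.sum_eq hS (fun i => w i • X i) fun i hi => by rw [hw0 i hi, zero_smul]]
      simp only [hwt]
    · rw [he.sum_eq hS w hw0, hwt, hwt, hwt, ← Fin.sum_univ_three]; exact h1

/-- The points `X i` are in general position: no three are coplanar with the origin, and no four
are coplanar. -/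
structure PointsInGeneralPosition (e : Finset ι → Fin 3 → ι)
    (X : ι → EuclideanSpace ℝ (Fin 3)) : Prop where
  det_ne_zero : ∀ S : Finset ι, S.card = 3 → det3 (X (e S 0)) (X (e S 1)) (X (e S 2)) ≠ 0
  faceFunctional_ne_one : ∀ S : Finset ι, S.card = 3 → ∀ m ∉ S, faceFunctional e X S (X m) ≠ 1

theorem PointsInGeneralPosition.ae_inGeneralPosition {e : Finset ι → Fin 3 → ι}
    (he : IsEnumeration e) {X : ι → EuclideanSpace ℝ (Fin 3)}
    (hX : PointsInGeneralPosition e X) :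
    ∀ᵐ z : EuclideanSpace ℝ (Fin 3), InGeneralPosition X 3 (faceFunctional e X) z := by
  classical
  have hae : ∀ S : Finset ι, ∀ᵐ z : EuclideanSpace ℝ (Fin 3), S.card = 3 →
      (det3 z (X (e S 1)) (X (e S 2)) ≠ 0 ∧ det3 (X (e S 0)) z (X (e S 2)) ≠ 0 ∧
        det3 (X (e S 0)) (X (e S 1)) z ≠ 0) ∧ faceFunctional e X S z ≠ 1 := by
    intro S
    by_cases hS : S.card = 3
    swap
    · exact Filter.Eventually.of_forall fun z h => absurd h hS
    have hd := hX.det_ne_zero S hS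
    have hd1 := hd
    rw [← det3_rotate] at hd1
    have hd2 := hd1
    rw [← det3_rotate] at hd2
    filter_upwards [nullOnPlanes_volume.ae_ne (crossVec_ne_zero hd) 0,
      nullOnPlanes_volume.ae_ne (crossVec_ne_zero hd1) 0,
      nullOnPlanes_volume.ae_ne (crossVec_ne_zero hd2) 0,
      nullOnPlanes_volume.ae_ne (planeNormal_ne_zero hd)
        (det3 (X (e S 0)) (X (e S 1)) (X (e S 2)))] with z h0 h1 h2 h3 _
    rw [inner_crossVec] at h0 h1 h2
    refine ⟨⟨h0, ?_, ?_⟩, ?_⟩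
    · rwa [← det3_rotate]
    · rwa [← det3_rotate, ← det3_rotate]
    · rw [faceFunctional, planeFunctional_apply]
      intro hc
      rw [inv_mul_eq_one₀ hd] at hc
      exact h3 hc.symm
  rw [← ae_all_iff] at hae
  filter_upwards [hae] with z hz
  constructor
  · intro S hS y
    have hd := hX.det_ne_zero S hS
    set d := det3 (X (e S 0)) (X (e S 1)) (X (e S 2)) with hd_def
    obtain ⟨w, hw0, hwt⟩ := he.exists_extend hS
      ![det3 y (X (e S 1)) (X (e S 2)) / d, det3 (X (e S 0)) y (X (e S 2)) / d,
        det3 (X (e S 0)) (X (e S 1)) y / d]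
    refine ⟨w, hw0, ?_⟩
    rw [he.sum_eq hS (fun i => w i • X i) fun i hi => by rw [hw0 i hi, zero_smul]]
    rw [hwt, hwt, hwt]
    have := det3_smul_eq (X (e S 0)) (X (e S 1)) (X (e S 2)) y
    rw [← hd_def] at this
    apply smul_right_injective _ hd
    simp only [Matrix.cons_val_zero, Matrix.cons_val_one, Matrix.cons_val, smul_add, smul_smul,
      mul_div_cancel₀ _ hd]
    exact this.symm
  · intro S hS i hi
    obtain ⟨k, rfl⟩ := ((he S hS).2 i).1 hi
    have hd := hX.det_ne_zero S hS
    rw [faceFunctional, planeFunctional_apply]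
    have : inner ℝ (planeNormal (X (e S 0)) (X (e S 1)) (X (e S 2))) (X (e S k)) =
        det3 (X (e S 0)) (X (e S 1)) (X (e S 2)) := by
      fin_cases k
      · exact inner_planeNormal_left _ _ _
      · exact inner_planeNormal_mid _ _ _
      · exact inner_planeNormal_right _ _ _
    rw [this, inv_mul_cancel₀ hd]
  · exact hX.faceFunctional_ne_one
  · rintro S hS w ⟨-, hw0, hwz⟩ i hi
    obtain ⟨⟨h0, h1, h2⟩, -⟩ := hz S hS
    rw [he.sum_eq hS (fun i => w i • X i) fun i hi => by rw [hw0 i hi, zero_smul]] at hwz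
    obtain ⟨k, rfl⟩ := ((he S hS).2 i).1 hi
    rw [← hwz] at h0 h1 h2
    intro hk
    fin_cases k
    · apply h0
      simp only [Fin.zero_eta] at hk
      rw [hk]; simp [det3]; ring
    · apply h1
      simp only [Fin.mk_one] at hk
      rw [hk]; simp [det3]; ring
    · apply h2
      simp only [Fin.reduceFinMk] at hk
      rw [hk]; simp [det3]; ring
  · exact fun S hS => (hz S hS).2

open Classical in
/-- The volume of a polytope as a signed sum over the triples of its vertices. -/
theorem PointsInGeneralPosition.volume_convexHull {e : Finset ι → Fin 3 → ι}
    (he : IsEnumeration e) {X : ι → EuclideanSpace ℝ (Fin 3)}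
    (hX : PointsInGeneralPosition e X) (hcard : 3 ≤ Fintype.card ι) :
    volume (convexHull ℝ (Set.range X)) +
      ∑ S ∈ Finset.powersetCard 3 Finset.univ, (if ∀ m ∉ S, 1 < faceFunctional e X S (X m) then
        ENNReal.ofReal (|det3 (X (e S 0)) (X (e S 1)) (X (e S 2))| / 6) else 0) =
      ∑ S ∈ Finset.powersetCard 3 Finset.univ, (if ∀ m ∉ S, faceFunctional e X S (X m) < 1 then
        ENNReal.ofReal (|det3 (X (e S 0)) (X (e S 1)) (X (e S 2))| / 6) else 0) := by
  have hmeas : MeasurableSet (convexHull ℝ (Set.range X)) :=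
    ((Set.finite_range X).isCompact_convexHull ℝ).measurableSet
  have hcone : ∀ (S : Finset ι), MeasurableSet (cone3 (X (e S 0)) (X (e S 1)) (X (e S 2))) :=
    fun S => (isCompact_cone3 _ _ _).measurableSet
  have hterm : ∀ (S : Finset ι) (p : Prop) [Decidable p],
      (if p then ENNReal.ofReal (|det3 (X (e S 0)) (X (e S 1)) (X (e S 2))| / 6) else 0) =
      ∫⁻ z, (if p then
        (cone3 (X (e S 0)) (X (e S 1)) (X (e S 2))).indicator 1 z else 0) := by
    intro S p _
    split_ifs
    · rw [lintegral_indicator_one (hcone S), volume_cone3]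
    · simp
  have hm : ∀ (S : Finset ι) (p : Prop) [Decidable p], Measurable fun z => if p then
      (cone3 (X (e S 0)) (X (e S 1)) (X (e S 2))).indicator
        (1 : EuclideanSpace ℝ (Fin 3) → ENNReal) z else 0 := by
    intro S p _
    split_ifs
    · exact measurable_one.indicator (hcone S)
    · exact measurable_const
  simp_rw [hterm]
  rw [← lintegral_finsetSum _ fun S _ => hm S _, ← lintegral_finsetSum _ fun S _ => hm S _,
    ← lintegral_indicator_one hmeas, ← lintegral_add_left (measurable_one.indicator hmeas)]
  refine lintegral_congr_ae ?_
  filter_upwards [hX.ae_inGeneralPosition he] with z hz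
  have := hz.indicator_convexHull hcard three_pos
  have hS : ∀ S ∈ Finset.powersetCard 3 (Finset.univ : Finset ι), ∀ (p : Prop) [Decidable p],
      (if p ∧ ∃ w, IsCombination X S w z ∧ ∑ i, w i ≤ 1 then (1 : ENNReal) else 0) =
      if p then (cone3 (X (e S 0)) (X (e S 1)) (X (e S 2))).indicator 1 z else 0 := by
    intro S hS p _
    rw [he.exists_isCombination_iff X (by simpa using hS)]
    simp only [ite_and, Set.indicator, Pi.one_apply]
  rw [Finset.sum_congr rfl fun S h => hS S h _, Finset.sum_congr rfl fun S h => hS S h _] at this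
  simpa only [Set.indicator, Pi.one_apply] using this

end Decomposition

/-- Inverse stereographic projection from the north pole. -/
noncomputable def stereo (z : ℂ) : EuclideanSpace ℝ (Fin 3) :=
  !₂[2 * z.re / (1 + Complex.normSq z), 2 * z.im / (1 + Complex.normSq z),
    (Complex.normSq z - 1) / (1 + Complex.normSq z)]

/-- The density of the uniform distribution of the sphere in stereographic coordinates. -/
noncomputable def stereoDensity (z : ℂ) : ENNReal :=
  ENNReal.ofReal (1 / (Real.pi * (1 + Complex.normSq z) ^ 2))

/-- The uniform distribution of the sphere, as a push-forward under stereographic projection. -/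
noncomputable def stereoLaw : Measure (EuclideanSpace ℝ (Fin 3)) :=
  (volume.withDensity stereoDensity).map stereo

theorem one_add_normSq_pos (z : ℂ) : 0 < 1 + Complex.normSq z := by
  have := Complex.normSq_nonneg z; linarith

theorem continuous_stereo : Continuous stereo := by
  have h : ∀ z, (1 + Complex.normSq z) ≠ 0 := fun z => (one_add_normSq_pos z).ne'
  unfold stereo
  refine (PiLp.continuous_toLp 2 _).comp ?_
  refine continuous_pi fun i => ?_
  have := Complex.continuous_re
  have := Complex.continuous_im
  have := Complex.continuous_normSq
  fin_cases i <;> simp <;> fun_prop (disch := exact h _)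

theorem measurable_stereoDensity : Measurable stereoDensity := by
  unfold stereoDensity
  have := Complex.continuous_normSq.measurable
  fun_prop

theorem lintegral_stereoLaw {F : EuclideanSpace ℝ (Fin 3) → ENNReal} (hF : Measurable F) :
    ∫⁻ x, F x ∂stereoLaw = ∫⁻ z, stereoDensity z * F (stereo z) := by
  rw [stereoLaw, lintegral_map hF continuous_stereo.measurable,
    lintegral_withDensity_eq_lintegral_mul _ measurable_stereoDensity
      (show Measurable fun z => F (stereo z) from hF.comp continuous_stereo.measurable)]
  rfl

theorem normSq_mobius_num_add {a b : ℂ} (h : Complex.normSq a + Complex.normSq b = 1) (z : ℂ) :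
    Complex.normSq (-star b * z + star a) + Complex.normSq (a * z + b) = 1 + Complex.normSq z := by
  simp only [Complex.normSq_apply] at *
  simp
  linear_combination (1 + z.re * z.re + z.im * z.im) * h

/-- The spherical density is invariant under the Möbius transformations in `SU(2)`. -/
theorem lintegral_stereoDensity_mobius {a b : ℂ} (h : Complex.normSq a + Complex.normSq b = 1)
    (F : ℂ → ENNReal) :
    ∫⁻ z, stereoDensity z * F ((a * z + b) / (-star b * z + star a)) =
      ∫⁻ z, stereoDensity z * F z := by
  have hab : a * star a + b * star b = 1 := by
    simp only [Complex.star_def, Complex.mul_conj]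
    exact_mod_cast h
  have key : ∀ (p q : ℂ), p * star p + q * star q = 1 → ∀ᵐ z : ℂ, p * z + q ≠ 0 := by
    intro p q hpq
    have : {z : ℂ | p * z + q = 0}.Countable := by
      refine Set.Subsingleton.countable ?_
      intro x hx y hy
      rw [Set.mem_ofPred_eq] at hx hy
      by_cases hp : p = 0
      · subst hp; simp at hx; subst hx; simp at hpq
      · exact mul_left_cancel₀ hp (by linear_combination hx - hy)
    simpa [ae_iff] using this.measure_zero volume
  set s : Set ℂ := {z | -star b * z + star a ≠ 0} with hs
  set t : Set ℂ := {z | star b * z + a ≠ 0} with ht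
  set f : ℂ → ℂ := fun z => (a * z + b) / (-star b * z + star a) with hf
  have hsm : MeasurableSet s := by
    refine (measurableSet_eq_fun (f := fun z : ℂ => -star b * z + star a) (g := fun _ => 0)
      ?_ measurable_const).compl
    fun_prop
  have hs1 : ∀ᵐ z : ℂ, z ∈ s := by
    refine key (-star b) (star a) ?_
    simp only [star_neg, star_star]; linear_combination hab
  have ht1 : ∀ᵐ z : ℂ, z ∈ t := by
    refine key (star b) a ?_
    simp only [star_star]; linear_combination hab
  have hst : f '' s = t := by
    ext w
    constructor
    · rintro ⟨z, hz, rfl⟩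
      rw [hs, Set.mem_ofPred_eq] at hz
      rw [ht, Set.mem_ofPred_eq, hf]
      have : star b * ((a * z + b) / (-star b * z + star a)) + a = 1 / (-star b * z + star a) := by
        generalize hD : -star b * z + star a = D at hz ⊢
        field_simp
        rw [← hD]
        linear_combination hab
      rw [this]
      exact one_div_ne_zero hz
    · intro hw
      rw [ht, Set.mem_ofPred_eq] at hw
      have h1 : -star b * ((star a * w - b) / (star b * w + a)) + star a =
          1 / (star b * w + a) := by
        field_simp
        linear_combination hab
      refine ⟨(star a * w - b) / (star b * w + a), ?_, ?_⟩
      · rw [hs, Set.mem_ofPred_eq, h1]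
        exact one_div_ne_zero hw
      · rw [hf]; dsimp only
        rw [h1]
        generalize hD : star b * w + a = D at hw ⊢
        field_simp
        rw [← hD]
        linear_combination w * hab
  have hinj : Set.InjOn f s := by
    intro x hx y hy hxy
    rw [hs, Set.mem_ofPred_eq] at hx hy
    rw [hf] at hxy
    dsimp only at hxy
    rw [div_eq_div_iff hx hy] at hxy
    linear_combination hxy - (x - y) * hab
  have hderiv : ∀ z ∈ s, HasDerivAt f (1 / (-star b * z + star a) ^ 2) z := by
    intro z hz
    rw [hs, Set.mem_ofPred_eq] at hz
    have h1 : HasDerivAt (fun z : ℂ => a * z + b) a z := by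
      simpa using ((hasDerivAt_id z).const_mul a).add_const b
    have h2 : HasDerivAt (fun z : ℂ => -star b * z + star a) (-star b) z := by
      simpa using ((hasDerivAt_id z).const_mul (-star b)).add_const (star a)
    refine (h1.div h2 hz).congr_deriv ?_
    congr 1
    linear_combination hab
  have hJ := lintegral_image_eq_lintegral_abs_det_fderiv_mul (volume : Measure ℂ) hsm
    (fun z hz => ((hderiv z hz).hasFDerivAt.restrictScalars ℝ).hasFDerivWithinAt) hinj
    (fun z => stereoDensity z * F z)
  rw [hst, setLIntegral_congr (t := Set.univ) (s := t) (Filter.eventuallyEq_univ.2 ht1),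
    setLIntegral_univ] at hJ
  rw [hJ, ← setLIntegral_univ (f := fun z => stereoDensity z * F (f z)),
    ← setLIntegral_congr (s := s) (t := Set.univ) (Filter.eventuallyEq_univ.2 hs1)]
  refine setLIntegral_congr_fun hsm fun z hz => ?_
  rw [← mul_assoc]
  congr 1
  have hdet : (ContinuousLinearMap.restrictScalars ℝ
      (ContinuousLinearMap.toSpanSingleton ℂ (1 / (-star b * z + star a) ^ 2))).det
      = Complex.normSq (1 / (-star b * z + star a) ^ 2) := by
    simp [ContinuousLinearMap.det, LinearMap.det_restrictScalars, Algebra.norm_complex_apply]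
  rw [hdet, abs_of_nonneg (Complex.normSq_nonneg _), stereoDensity, stereoDensity,
    ← ENNReal.ofReal_mul (Complex.normSq_nonneg _)]
  congr 1
  have h3 := normSq_mobius_num_add h z
  rw [hs, Set.mem_ofPred_eq, ← Complex.normSq_pos] at hz
  rw [hf]
  simp only [Complex.normSq_div, map_pow, map_one]
  have h4 := Complex.normSq_nonneg (a * z + b)
  generalize Complex.normSq (-star b * z + star a) = D at hz h3 ⊢
  have h5 : 1 + Complex.normSq (a * z + b) / D = (1 + Complex.normSq z) / D := by
    rw [← h3]; field_simp
  rw [h5]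
  have := one_add_normSq_pos z
  field_simp

theorem exists_mobius_inner_stereo {v : EuclideanSpace ℝ (Fin 3)} (hv : ‖v‖ = 1) :
    ∃ a b : ℂ, Complex.normSq a + Complex.normSq b = 1 ∧ ∀ z, -star b * z + star a ≠ 0 →
      inner ℝ v (stereo z) = stereo ((a * z + b) / (-star b * z + star a)) 2 := by
  have hv1 : v 0 * v 0 + v 1 * v 1 + v 2 * v 2 = 1 := by
    rw [← inner_fin_three, real_inner_self_eq_norm_sq, hv]; norm_num
  have red : ∀ a b : ℂ, Complex.normSq a + Complex.normSq b = 1 →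
      Complex.normSq a - Complex.normSq b = v 2 → 2 * a.re * b.re + 2 * a.im * b.im = v 0 →
      2 * a.re * b.im - 2 * a.im * b.re = v 1 → 
      ∀ z, -star b * z + star a ≠ 0 →
      inner ℝ v (stereo z) = stereo ((a * z + b) / (-star b * z + star a)) 2 := by
    intro a b hab h2 h0 h1 z hz
    have h3 := normSq_mobius_num_add hab z
    have h4 := one_add_normSq_pos z
    rw [← Complex.normSq_pos] at hz
    rw [inner_fin_three]
    simp only [stereo, Complex.normSq_div]
    simp only [Matrix.cons_val]
    have h5 : (Complex.normSq (a * z + b) / Complex.normSq (-star b * z + star a) - 1) /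
        (1 + Complex.normSq (a * z + b) / Complex.normSq (-star b * z + star a)) =
        (Complex.normSq (a * z + b) - Complex.normSq (-star b * z + star a)) /
          (1 + Complex.normSq z) := by
      have := Complex.normSq_nonneg (a * z + b)
      rw [← h3]
      generalize Complex.normSq (-star b * z + star a) = D at hz ⊢
      field_simp
    rw [h5, ← h0, ← h1, ← h2]
    field_simp
    simp only [Complex.normSq_apply]
    simp
    ring
  by_cases h : v 2 = -1
  · refine ⟨0, 1, by simp, red 0 1 (by simp) (by simp [h]) ?_ ?_⟩
    · simp; nlinarith
    · simp; nlinarith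
  · have hlt : 0 < 1 + v 2 := by
      have : -1 ≤ v 2 := by nlinarith
      exact lt_of_le_of_ne (by linarith) (fun hh => h (by linarith))
    set r := Real.sqrt ((1 + v 2) / 2) with hr
    have hr2 : r * r = (1 + v 2) / 2 := Real.mul_self_sqrt (by positivity)
    have hr0 : 0 < r := Real.sqrt_pos.2 (by positivity)
    have hb : (v 0 / (2 * r)) * (v 0 / (2 * r)) + (v 1 / (2 * r)) * (v 1 / (2 * r))
        = (1 - v 2) / 2 := by
      have : (v 0 / (2 * r)) * (v 0 / (2 * r)) + (v 1 / (2 * r)) * (v 1 / (2 * r))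
        = (v 0 * v 0 + v 1 * v 1) / (4 * (r * r)) := by field_simp; ring
      rw [this, hr2]; field_simp; linear_combination 4 * hv1
    have e1 : Complex.normSq (r : ℂ) + Complex.normSq ⟨v 0 / (2 * r), v 1 / (2 * r)⟩ = 1 := by
      simp only [Complex.normSq_apply, Complex.ofReal_re, Complex.ofReal_im]
      rw [hb, hr2]; ring
    refine ⟨r, ⟨v 0 / (2 * r), v 1 / (2 * r)⟩, e1, red _ _ e1 ?_ ?_ ?_⟩
    · simp only [Complex.normSq_apply, Complex.ofReal_re, Complex.ofReal_im]
      rw [hb, hr2]; ring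
    · simp; field_simp
    · simp; field_simp

/-- All the one-dimensional projections of `stereoLaw` agree. -/
theorem lintegral_inner_stereoLaw {v : EuclideanSpace ℝ (Fin 3)} (hv : ‖v‖ = 1)
    {g : ℝ → ENNReal} (hg : Measurable g) :
    ∫⁻ x, g (inner ℝ v x) ∂stereoLaw =
      ∫⁻ z : ℂ, stereoDensity z * g ((Complex.normSq z - 1) / (1 + Complex.normSq z)) := by
  obtain ⟨a, b, hab, h⟩ := exists_mobius_inner_stereo hv
  rw [lintegral_stereoLaw (by fun_prop),
    ← lintegral_stereoDensity_mobius hab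
      (fun z => g ((Complex.normSq z - 1) / (1 + Complex.normSq z)))]
  refine lintegral_congr_ae ?_
  have : {z : ℂ | -star b * z + star a = 0}.Countable := by
    refine Set.Subsingleton.countable ?_
    intro x hx y hy
    rw [Set.mem_ofPred_eq] at hx hy
    by_cases hp : star b = 0
    · rw [hp] at hx
      simp at hx hp
      simp [hx, hp] at hab
    · exact mul_left_cancel₀ hp (by linear_combination hy - hx)
  filter_upwards [show ∀ᵐ z : ℂ, -star b * z + star a ≠ 0 by
    simpa [ae_iff] using this.measure_zero volume] with z hz
  rw [h z hz]
  rfl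

/-- The uniform distribution on `(-1, 1)`. -/
noncomputable def capLaw : Measure ℝ :=
  ENNReal.ofReal (1 / 2) • volume.restrict (Set.Ioo (-1) 1)

theorem lintegral_stereoDensity_radial {g : ℝ → ENNReal} (hg : Measurable g) :
    ∫⁻ z : ℂ, stereoDensity z * g ((Complex.normSq z - 1) / (1 + Complex.normSq z)) =
      ∫⁻ t, g t ∂capLaw := by
  set T : ℝ → ℝ := fun r => (r ^ 2 - 1) / (1 + r ^ 2) with hT
  have hpos : ∀ r : ℝ, 0 < 1 + r ^ 2 := fun r => by positivity
  have hTm : Measurable T := by fun_prop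
  have himage : T '' Set.Ioi 0 = Set.Ioo (-1) 1 := by
    ext t
    constructor
    · rintro ⟨r, hr, rfl⟩
      have hr0 : (0 : ℝ) < r := hr
      refine Set.mem_Ioo.2 ⟨?_, ?_⟩
      · rw [hT]; dsimp only; rw [lt_div_iff₀ (hpos r)]; nlinarith
      · rw [hT]; dsimp only; rw [div_lt_iff₀ (hpos r)]; nlinarith
    · intro ht
      obtain ⟨h1, h2⟩ := Set.mem_Ioo.1 ht
      have h3 : 0 < 1 - t := by linarith
      have h4 : 0 < (1 + t) / (1 - t) := div_pos (by linarith) h3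
      refine ⟨Real.sqrt ((1 + t) / (1 - t)), Set.mem_Ioi.2 (Real.sqrt_pos.2 h4), ?_⟩
      rw [hT]; dsimp only
      rw [Real.sq_sqrt h4.le, div_eq_iff (by positivity)]
      field_simp
      ring
  have hinj : Set.InjOn T (Set.Ioi 0) := by
    intro x hx y hy hxy
    have hx0 : (0 : ℝ) < x := hx
    have hy0 : (0 : ℝ) < y := hy
    rw [hT] at hxy; dsimp only at hxy
    rw [div_eq_div_iff (hpos x).ne' (hpos y).ne'] at hxy
    exact (pow_left_inj₀ hx0.le hy0.le two_ne_zero).1 (by linarith)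
  have hderiv : ∀ r ∈ Set.Ioi (0 : ℝ),
      HasDerivWithinAt T (4 * r / (1 + r ^ 2) ^ 2) (Set.Ioi 0) r := by
    intro r _
    have h1 : HasDerivAt (fun r : ℝ => r ^ 2 - 1) (2 * r) r := by
      simpa using (hasDerivAt_pow 2 r).sub_const 1
    have h2 : HasDerivAt (fun r : ℝ => 1 + r ^ 2) (2 * r) r := by
      simpa using (hasDerivAt_pow 2 r).const_add 1
    refine ((h1.div h2 (hpos r).ne').congr_deriv ?_).hasDerivWithinAt
    congr 1; ring
  have hcov := lintegral_image_eq_lintegral_abs_deriv_mul measurableSet_Ioi hderiv hinj g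
  rw [capLaw, lintegral_smul_measure, ← himage, hcov]
  rw [← Complex.lintegral_comp_polarCoord_symm, polarCoord_target, Measure.volume_eq_prod,
    ← Measure.prod_restrict]
  have hnorm : ∀ p : ℝ × ℝ, Complex.normSq (Complex.polarCoord.symm p) = p.1 ^ 2 := by
    intro p
    rw [Complex.normSq_eq_norm_sq, Complex.norm_polarCoord_symm, sq_abs]
  simp only [hnorm, stereoDensity]
  rw [lintegral_prod _ (by fun_prop)]
  rw [smul_eq_mul, ← lintegral_const_mul _ (by fun_prop)]
  refine setLIntegral_congr_fun measurableSet_Ioi fun r hr => ?_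
  have hr0 : (0 : ℝ) < r := hr
  dsimp only
  rw [lintegral_const, Measure.restrict_apply_univ, Real.volume_Ioo, smul_eq_mul,
    abs_of_nonneg (by positivity), hT]
  dsimp only
  rw [← mul_assoc, ← mul_assoc, mul_right_comm, ← ENNReal.ofReal_mul hr0.le,
    ← ENNReal.ofReal_mul (by positivity), ← ENNReal.ofReal_mul (by positivity)]
  congr 2
  have := hpos r
  have := Real.pi_pos
  field_simp
  ring

theorem map_inner_stereoLaw {v : EuclideanSpace ℝ (Fin 3)} (hv : ‖v‖ = 1) :
    stereoLaw.map (fun x => inner ℝ v x) = capLaw := by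
  refine Measure.ext_of_lintegral _ fun g hg => ?_
  rw [lintegral_map hg (by fun_prop), lintegral_inner_stereoLaw hv hg,
    lintegral_stereoDensity_radial hg]

instance : IsProbabilityMeasure capLaw := by
  constructor
  rw [capLaw, Measure.smul_apply, Measure.restrict_apply_univ, Real.volume_Ioo, smul_eq_mul,
    ← ENNReal.ofReal_mul (by norm_num)]
  norm_num

theorem norm_stereo (z : ℂ) : ‖stereo z‖ = 1 := by
  have h : ‖stereo z‖ ^ 2 = 1 := by
    rw [← real_inner_self_eq_norm_sq, inner_fin_three]
    simp only [stereo, Matrix.cons_val]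
    have := one_add_normSq_pos z
    field_simp
    rw [Complex.normSq_apply]
    ring
  exact (pow_eq_one_iff_of_nonneg (norm_nonneg _) two_ne_zero).1 h

instance : IsProbabilityMeasure stereoLaw := by
  have hv : ‖(EuclideanSpace.single 0 1 : EuclideanSpace ℝ (Fin 3))‖ = 1 := by simp
  have h := congrArg (fun m => m Set.univ) (map_inner_stereoLaw hv)
  rw [Measure.map_apply (by fun_prop) MeasurableSet.univ, measure_univ] at h
  exact ⟨by simpa using h⟩

theorem ae_norm_stereoLaw : ∀ᵐ x ∂stereoLaw, ‖x‖ = 1 := by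
  rw [stereoLaw, ae_map_iff continuous_stereo.measurable.aemeasurable
    (measurableSet_eq_fun (by fun_prop) (by fun_prop))]
  exact Filter.Eventually.of_forall norm_stereo

/-- An isometry-invariant probability measure on the sphere is equal to `stereoLaw`. -/
theorem eq_stereoLaw (P : Measure (EuclideanSpace ℝ (Fin 3))) [IsProbabilityMeasure P]
    (hP : ∀ᵐ x ∂P, ‖x‖ = 1)
    (hinv : ∀ R : EuclideanSpace ℝ (Fin 3) ≃ₗᵢ[ℝ] EuclideanSpace ℝ (Fin 3), P.map R = P) :
    P = stereoLaw := by
  set e : EuclideanSpace ℝ (Fin 3) := EuclideanSpace.single 0 1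
  have he : ‖e‖ = 1 := by simp [e]
  have hQ : ∀ (s : ℝ) (v : EuclideanSpace ℝ (Fin 3)), ‖v‖ = 1 →
      charFun stereoLaw (s • v) = charFun stereoLaw (s • e) := by
    have : ∀ (s : ℝ) (v : EuclideanSpace ℝ (Fin 3)), ‖v‖ = 1 →
        charFun stereoLaw (s • v) = charFun capLaw s := by
      intro s v hv
      rw [charFun_apply, charFun_apply, ← map_inner_stereoLaw hv,
        integral_map (by fun_prop) (by fun_prop)]
      refine integral_congr_ae (Filter.Eventually.of_forall fun x => ?_)
      simp only [inner_smul_right, real_inner_comm]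
      simp [mul_comm]
    intro s v hv
    rw [this s v hv, this s e he]
  have hPs : ∀ (s : ℝ) (v : EuclideanSpace ℝ (Fin 3)), ‖v‖ = 1 →
      charFun P (s • v) = charFun P (s • e) := by
    intro s v hv
    set R := Submodule.reflection (ℝ ∙ (v - e))ᗮ
    have hR : R v = e := Submodule.reflection_sub (by rw [hv, he])
    rw [charFun_apply, charFun_apply]
    conv_rhs => rw [← hinv R, integral_map (by fun_prop) (by fun_prop)]
    refine integral_congr_ae (Filter.Eventually.of_forall fun x => ?_)
    dsimp only
    rw [← hR, ← map_smul, LinearIsometryEquiv.inner_map_map]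
  have heq : ∀ s : ℝ, charFun P (s • e) = charFun stereoLaw (s • e) := by
    intro s
    have hswap := integral_integral_swap (μ := P) (ν := stereoLaw)
      (f := fun x y => Complex.exp (((inner ℝ x (s • y) : ℝ) : ℂ) * Complex.I)) (by
        refine Integrable.of_bound (C := 1) (Continuous.aestronglyMeasurable (by fun_prop)) ?_
        refine Filter.Eventually.of_forall fun p => ?_
        exact (Complex.norm_exp_ofReal_mul_I _).le)
    have h1 : ∀ᵐ x ∂P, ∫ y, Complex.exp (((inner ℝ x (s • y) : ℝ) : ℂ) * Complex.I) ∂stereoLaw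
        = charFun stereoLaw (s • e) := by
      filter_upwards [hP] with x hx
      rw [← hQ s x hx, charFun_apply]
      simp only [inner_smul_right, real_inner_comm]
    have h2 : ∀ᵐ y ∂stereoLaw, ∫ x, Complex.exp (((inner ℝ x (s • y) : ℝ) : ℂ) * Complex.I) ∂P
        = charFun P (s • e) := by
      filter_upwards [ae_norm_stereoLaw] with y hy
      rw [← hPs s y hy, charFun_apply]
    rw [integral_congr_ae h1, integral_congr_ae h2] at hswap
    simpa using hswap.symm
  refine Measure.ext_of_charFun (funext fun t => ?_)
  by_cases ht : t = 0
  · simp [ht]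
  · have h1 : t = ‖t‖ • (‖t‖⁻¹ • t) := by
      rw [smul_smul, mul_inv_cancel₀ (norm_ne_zero_iff.2 ht), one_smul]
    have h2 : ‖‖t‖⁻¹ • t‖ = 1 := by
      rw [norm_smul, norm_inv, norm_norm, inv_mul_cancel₀ (norm_ne_zero_iff.2 ht)]
    rw [h1, hPs _ _ h2, hQ _ _ h2, heq]

theorem norm_stereo_sub_sq (z w : ℂ) :
    ‖stereo z - stereo w‖ ^ 2 =
      4 * Complex.normSq (z - w) / ((1 + Complex.normSq z) * (1 + Complex.normSq w)) := by
  have hz := one_add_normSq_pos z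
  have hw := one_add_normSq_pos w
  rw [← real_inner_self_eq_norm_sq, inner_fin_three]
  simp only [stereo, PiLp.sub_apply, Matrix.cons_val]
  field_simp
  simp only [Complex.normSq_apply, Complex.sub_re, Complex.sub_im]
  ring

theorem lipschitzWith_stereo :
    LipschitzWith 3 (fun p : ℝ × ℝ => stereo ⟨p.1, p.2⟩) := by
  refine LipschitzWith.of_dist_le_mul fun p q => ?_
  rw [dist_eq_norm]
  refine abs_le_of_sq_le_sq' ?_ (by positivity) |>.2
  rw [norm_stereo_sub_sq]
  have h1 : |p.1 - q.1| ≤ dist p q := by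
    rw [← Real.dist_eq, Prod.dist_eq]; exact le_max_left _ _
  have h2 : |p.2 - q.2| ≤ dist p q := by
    rw [← Real.dist_eq, Prod.dist_eq]; exact le_max_right _ _
  have h3 := sq_le_sq' (by linarith [neg_abs_le (p.1 - q.1)]) ((le_abs_self _).trans h1)
  have h4 := sq_le_sq' (by linarith [neg_abs_le (p.2 - q.2)]) ((le_abs_self _).trans h2)
  have h5 : Complex.normSq ((⟨p.1, p.2⟩ : ℂ) - ⟨q.1, q.2⟩) = (p.1 - q.1) ^ 2 + (p.2 - q.2) ^ 2 := by
    simp [Complex.normSq_apply, sq]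
  have h6 := Complex.normSq_nonneg (⟨p.1, p.2⟩ : ℂ)
  have h7 := Complex.normSq_nonneg (⟨q.1, q.2⟩ : ℂ)
  have h8 : 1 ≤ (1 + Complex.normSq (⟨p.1, p.2⟩ : ℂ)) * (1 + Complex.normSq (⟨q.1, q.2⟩ : ℂ)) := by
    nlinarith
  refine (div_le_self (by have := Complex.normSq_nonneg ((⟨p.1, p.2⟩ : ℂ) - ⟨q.1, q.2⟩); linarith)
    h8).trans ?_
  rw [h5, mul_pow]
  norm_num
  nlinarith [sq_nonneg (dist p q)]

theorem mem_sphere_iff_sq (x : EuclideanSpace ℝ (Fin 3)) :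
    x ∈ Metric.sphere (0 : EuclideanSpace ℝ (Fin 3)) 1 ↔ x 0 * x 0 + x 1 * x 1 + x 2 * x 2 = 1 := by
  rw [mem_sphere_zero_iff_norm, ← inner_fin_three, real_inner_self_eq_norm_sq,
    pow_eq_one_iff_of_nonneg (norm_nonneg _) two_ne_zero]

theorem hausdorffMeasure_sphere_ne_top :
    (μH[2] : Measure (EuclideanSpace ℝ (Fin 3))) (Metric.sphere 0 1) ≠ ⊤ := by
  set A : Set (EuclideanSpace ℝ (Fin 3)) :=
    (fun p : ℝ × ℝ => stereo ⟨p.1, p.2⟩) '' (Set.Icc (-1) 1 ×ˢ Set.Icc (-1) 1) with hA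
  have hAfin : (μH[2] : Measure (EuclideanSpace ℝ (Fin 3))) A ≠ ⊤ := by
    refine ne_top_of_le_ne_top ?_
      (lipschitzWith_stereo.hausdorffMeasure_image_le (d := 2) (by norm_num) _)
    rw [hausdorffMeasure_prod_real, Measure.volume_eq_prod, Measure.prod_prod, Real.volume_Icc]
    exact ENNReal.mul_ne_top (by simp) (by finiteness)
  have hlow : ∀ x ∈ Metric.sphere (0 : EuclideanSpace ℝ (Fin 3)) 1, x 2 ≤ 0 → x ∈ A := by
    intro x hx hx2
    rw [mem_sphere_iff_sq] at hx
    have h1 : 0 < 1 - x 2 := by linarith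
    refine ⟨(x 0 / (1 - x 2), x 1 / (1 - x 2)), Set.mk_mem_prod ?_ ?_, ?_⟩
    · rw [Set.mem_Icc, ← abs_le, abs_div, abs_of_pos h1, div_le_one h1]
      exact abs_le_of_sq_le_sq (by nlinarith) h1.le
    · rw [Set.mem_Icc, ← abs_le, abs_div, abs_of_pos h1, div_le_one h1]
      exact abs_le_of_sq_le_sq (by nlinarith) h1.le
    · have h2 : Complex.normSq ⟨x 0 / (1 - x 2), x 1 / (1 - x 2)⟩ = (1 + x 2) / (1 - x 2) := by
        rw [Complex.normSq_apply]
        field_simp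
        linear_combination hx
      have h3 : 1 + Complex.normSq ⟨x 0 / (1 - x 2), x 1 / (1 - x 2)⟩ = 2 / (1 - x 2) := by
        rw [h2]; field_simp; ring
      ext i
      fin_cases i
      · simp only [stereo, h3]; simp; field_simp
      · simp only [stereo, h3]; simp; field_simp
      · simp only [stereo, h3]; simp [h2]; field_simp; ring
  have hneg : (μH[2] : Measure (EuclideanSpace ℝ (Fin 3))) (Neg.neg '' A) ≠ ⊤ := by
    rw [(isometry_neg : Isometry (fun x : EuclideanSpace ℝ (Fin 3) => -x)).hausdorffMeasure_image
      (Or.inl (by norm_num))]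
    exact hAfin
  have hsub : Metric.sphere (0 : EuclideanSpace ℝ (Fin 3)) 1 ⊆ A ∪ Neg.neg '' A := by
    intro x hx
    rcases le_total (x 2) 0 with h | h
    · exact Or.inl (hlow x hx h)
    · refine Or.inr ⟨-x, hlow (-x) (by simpa using hx) (by simpa using h), neg_neg x⟩
  exact ne_top_of_le_ne_top (ENNReal.add_ne_top.2 ⟨hAfin, hneg⟩)
    ((measure_mono hsub).trans (measure_union_le _ _))

theorem hausdorffMeasure_sphere_ne_zero :
    (μH[2] : Measure (EuclideanSpace ℝ (Fin 3))) (Metric.sphere 0 1) ≠ 0 := by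
  have hL : LipschitzWith 1 (fun x : EuclideanSpace ℝ (Fin 3) => (x 0, x 1)) := by
    refine LipschitzWith.of_dist_le_mul fun p q => ?_
    rw [Prod.dist_eq, NNReal.coe_one, one_mul, max_le_iff, Real.dist_eq, Real.dist_eq, dist_eq_norm]
    exact ⟨PiLp.norm_apply_le (p - q) 0, PiLp.norm_apply_le (p - q) 1⟩
  intro h0
  have h1 := hL.hausdorffMeasure_image_le (d := 2) (by norm_num)
    (Metric.sphere (0 : EuclideanSpace ℝ (Fin 3)) 1)
  rw [h0, mul_zero, hausdorffMeasure_prod_real] at h1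
  have h2 : (Set.Icc 0 (1 / 2) ×ˢ Set.Icc 0 (1 / 2) : Set (ℝ × ℝ)) ⊆
      (fun x : EuclideanSpace ℝ (Fin 3) => (x 0, x 1)) '' Metric.sphere 0 1 := by
    rintro ⟨a, b⟩ hab
    obtain ⟨ha, hb⟩ := Set.mem_prod.1 hab
    obtain ⟨ha1, ha2⟩ := Set.mem_Icc.1 ha
    obtain ⟨hb1, hb2⟩ := Set.mem_Icc.1 hb
    dsimp only at ha1 ha2 hb1 hb2
    refine ⟨!₂[a, b, Real.sqrt (1 - a * a - b * b)], ?_, by simp⟩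
    rw [mem_sphere_iff_sq]
    simp only [Matrix.cons_val]
    rw [Real.mul_self_sqrt (by nlinarith)]
    ring
  have h3 := (measure_mono h2).trans h1
  rw [Measure.volume_eq_prod, Measure.prod_prod, Real.volume_Icc,
    ← ENNReal.ofReal_mul (by norm_num)]
    at h3
  norm_num at h3

/-- The normalized two-dimensional Hausdorff measure of the unit sphere of `ℝ³`. -/
noncomputable def sphereLaw : Measure (EuclideanSpace ℝ (Fin 3)) :=
  ((μH[2] : Measure (EuclideanSpace ℝ (Fin 3))).restrict (Metric.sphere 0 1) Set.univ)⁻¹ •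
    (μH[2] : Measure (EuclideanSpace ℝ (Fin 3))).restrict (Metric.sphere 0 1)

instance : IsProbabilityMeasure sphereLaw := by
  constructor
  rw [sphereLaw, Measure.smul_apply, Measure.restrict_apply_univ, smul_eq_mul]
  exact ENNReal.inv_mul_cancel hausdorffMeasure_sphere_ne_zero hausdorffMeasure_sphere_ne_top

theorem ae_norm_sphereLaw : ∀ᵐ x ∂sphereLaw, ‖x‖ = 1 := by
  refine Measure.ae_smul_measure ?_ _
  filter_upwards [ae_restrict_mem Metric.isClosed_sphere.measurableSet] with x hx
  simpa using hx

theorem map_sphereLaw (R : EuclideanSpace ℝ (Fin 3) ≃ₗᵢ[ℝ] EuclideanSpace ℝ (Fin 3)) :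
    sphereLaw.map R = sphereLaw := by
  have h := (R.toIsometryEquiv.measurePreserving_hausdorffMeasure 2).restrict_preimage
    (s := Metric.sphere 0 1) Metric.isClosed_sphere.measurableSet
  have h2 : R.toIsometryEquiv ⁻¹' Metric.sphere 0 1 = Metric.sphere 0 1 := by
    ext x; simp
  rw [h2] at h
  rw [sphereLaw, Measure.map_smul]
  congr 1
  exact h.map_eq

theorem sphereLaw_eq_stereoLaw : sphereLaw = stereoLaw :=
  eq_stereoLaw _ ae_norm_sphereLaw map_sphereLaw

theorem map_inner_sphereLaw {v : EuclideanSpace ℝ (Fin 3)} (hv : ‖v‖ = 1) :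
    sphereLaw.map (fun x => inner ℝ v x) = capLaw := by
  rw [sphereLaw_eq_stereoLaw, map_inner_stereoLaw hv]

theorem capLaw_Iio {h : ℝ} (h2 : h ≤ 1) :
    capLaw (Set.Iio h) = ENNReal.ofReal ((1 + h) / 2) := by
  have : Set.Iio h ∩ Set.Ioo (-1) 1 = Set.Ioo (-1) h := by
    ext x; simp only [Set.mem_inter_iff, Set.mem_Iio, Set.mem_Ioo]
    constructor
    · rintro ⟨a, b, c⟩; exact ⟨b, a⟩
    · rintro ⟨a, b⟩; exact ⟨b, a, by linarith⟩
  rw [capLaw, Measure.smul_apply, Measure.restrict_apply measurableSet_Iio, this, Real.volume_Ioo,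
    smul_eq_mul, ← ENNReal.ofReal_mul (by norm_num)]
  congr 1; ring

theorem capLaw_Ioi {h : ℝ} (h1 : -1 ≤ h) :
    capLaw (Set.Ioi h) = ENNReal.ofReal ((1 - h) / 2) := by
  have : Set.Ioi h ∩ Set.Ioo (-1) 1 = Set.Ioo h 1 := by
    ext x; simp only [Set.mem_inter_iff, Set.mem_Ioi, Set.mem_Ioo]
    constructor
    · rintro ⟨a, b, c⟩; exact ⟨a, c⟩
    · rintro ⟨a, b⟩; exact ⟨a, by linarith, b⟩
  rw [capLaw, Measure.smul_apply, Measure.restrict_apply measurableSet_Ioi, this, Real.volume_Ioo,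
    smul_eq_mul, ← ENNReal.ofReal_mul (by norm_num)]
  congr 1; ring

theorem sphereLaw_inner_lt {p : EuclideanSpace ℝ (Fin 3)} (hp : p ≠ 0) {c : ℝ} (hc : |c| ≤ ‖p‖) :
    sphereLaw {x | inner ℝ p x < c} = ENNReal.ofReal ((1 + c / ‖p‖) / 2) := by
  have hp0 : 0 < ‖p‖ := norm_pos_iff.2 hp
  have hv : ‖‖p‖⁻¹ • p‖ = 1 := by
    rw [norm_smul, norm_inv, norm_norm, inv_mul_cancel₀ hp0.ne']
  have h1 : |c / ‖p‖| ≤ 1 := by rw [abs_div, abs_norm, div_le_one hp0]; exact hc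
  rw [← capLaw_Iio (abs_le.1 h1).2, ← map_inner_sphereLaw hv,
    Measure.map_apply (by fun_prop) measurableSet_Iio]
  congr 1
  ext x
  rw [Set.mem_ofPred_eq, Set.mem_preimage, Set.mem_Iio, real_inner_smul_left,
    inv_mul_eq_div, div_lt_div_iff_of_pos_right hp0]

theorem sphereLaw_lt_inner {p : EuclideanSpace ℝ (Fin 3)} (hp : p ≠ 0) {c : ℝ} (hc : |c| ≤ ‖p‖) :
    sphereLaw {x | c < inner ℝ p x} = ENNReal.ofReal ((1 - c / ‖p‖) / 2) := by
  have hp0 : 0 < ‖p‖ := norm_pos_iff.2 hp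
  have hv : ‖‖p‖⁻¹ • p‖ = 1 := by
    rw [norm_smul, norm_inv, norm_norm, inv_mul_cancel₀ hp0.ne']
  have h1 : |c / ‖p‖| ≤ 1 := by rw [abs_div, abs_norm, div_le_one hp0]; exact hc
  rw [← capLaw_Ioi (abs_le.1 h1).1, ← map_inner_sphereLaw hv,
    Measure.map_apply (by fun_prop) measurableSet_Ioi]
  congr 1
  ext x
  rw [Set.mem_ofPred_eq, Set.mem_preimage, Set.mem_Ioi, real_inner_smul_left,
    inv_mul_eq_div, div_lt_div_iff_of_pos_right hp0]

theorem nullOnPlanes_sphereLaw : NullOnPlanes sphereLaw := by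
  intro p hp c
  have hp0 : 0 < ‖p‖ := norm_pos_iff.2 hp
  have hv : ‖‖p‖⁻¹ • p‖ = 1 := by
    rw [norm_smul, norm_inv, norm_norm, inv_mul_cancel₀ hp0.ne']
  have h0 : capLaw {c / ‖p‖} = 0 := by
    rw [capLaw, Measure.smul_apply]
    simp
  rw [← map_inner_sphereLaw hv, Measure.map_apply (by fun_prop) (measurableSet_singleton _)] at h0
  rw [← h0]
  congr 1
  ext x
  rw [Set.mem_ofPred_eq, Set.mem_preimage, Set.mem_singleton_iff, real_inner_smul_left,
    inv_mul_eq_div, div_left_inj' hp0.ne']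

theorem lintegral_comp_affine (f : ℝ → ENNReal) {c : ℝ} (hc : c ≠ 0) (d : ℝ) :
    ∫⁻ x, f x = ENNReal.ofReal |c| * ∫⁻ s, f (c * s + d) := by
  have himage : (fun s : ℝ => c * s + d) '' Set.univ = Set.univ := by
    refine Set.eq_univ_of_forall fun x => ⟨(x - d) / c, Set.mem_univ _, ?_⟩
    dsimp only; field_simp; ring
  have hinj : Set.InjOn (fun s : ℝ => c * s + d) Set.univ := by
    intro x _ y _ hxy
    exact mul_left_cancel₀ hc (add_right_cancel hxy)
  have h := lintegral_image_eq_lintegral_abs_deriv_mul (f' := fun _ => c) MeasurableSet.univ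
    (fun x _ => (by simpa using ((hasDerivAt_id x).const_mul c).add_const d :
      HasDerivAt (fun s : ℝ => c * s + d) c x).hasDerivWithinAt)
    hinj f
  rw [himage, setLIntegral_univ, setLIntegral_univ] at h
  rw [h, lintegral_const_mul' _ _ ENNReal.ofReal_ne_top]

/-- Pairs of points of the plane, parametrized by the line they span and their abscissas. -/
theorem lintegral_pairs_by_line {f : ℝ → ℝ → ℝ → ℝ → ENNReal}
    (hf : Measurable fun p : ℝ × ℝ × ℝ × ℝ => f p.1 p.2.1 p.2.2.1 p.2.2.2) :
    ∫⁻ x, ∫⁻ y, ∫⁻ x', ∫⁻ y', f x y x' y' =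
      ∫⁻ s : ℝ, ∫⁻ a : ℝ, ∫⁻ x : ℝ, ∫⁻ x' : ℝ,
        ENNReal.ofReal |x' - x| * f x (a + s * x) x' (a + s * x') := by
  have hf' : ∀ {α : Type} [MeasurableSpace α] {a b c d : α → ℝ}, Measurable a → Measurable b →
      Measurable c → Measurable d → Measurable fun t => f (a t) (b t) (c t) (d t) :=
    fun ha hb hc hd => hf.comp (ha.prodMk (hb.prodMk (hc.prodMk hd)))
  have h1 : ∀ x, ∫⁻ y, ∫⁻ x', ∫⁻ y', f x y x' y' =
      ∫⁻ x' : ℝ, ∫⁻ s : ℝ, ∫⁻ a : ℝ,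
        ENNReal.ofReal |x' - x| * f x (a + s * x) x' (a + s * x') := by
    intro x
    rw [lintegral_lintegral_swap]
    swap
    · refine Measurable.aemeasurable ?_
      refine Measurable.lintegral_prod_right (f := fun (p : ℝ × ℝ) y' => f x p.1 p.2 y') ?_
      exact hf' (by fun_prop) (by fun_prop) (by fun_prop) (by fun_prop)
    refine lintegral_congr_ae ?_
    filter_upwards [compl_mem_ae_iff.2 (measure_singleton x)] with x' hx'
    have hne : x' - x ≠ 0 := sub_ne_zero.2 hx'
    have h2 : ∀ y, ∫⁻ y', f x y x' y' =
        ∫⁻ s, ENNReal.ofReal |x' - x| * f x y x' ((x' - x) * s + y) := by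
      intro y
      rw [lintegral_comp_affine _ hne y, lintegral_const_mul' _ _ ENNReal.ofReal_ne_top]
    simp only [h2]
    rw [lintegral_lintegral_swap]
    swap
    · refine Measurable.aemeasurable (Measurable.mul measurable_const ?_)
      exact hf' (by fun_prop) (by fun_prop) (by fun_prop) (by fun_prop)
    refine lintegral_congr fun s => ?_
    rw [← lintegral_add_right_eq_self _ (s * x)]
    refine lintegral_congr fun a => ?_
    congr 2
    ring
  simp only [h1]
  have h3 : Measurable fun q : (ℝ × ℝ) × (ℝ × ℝ) => ENNReal.ofReal |q.1.2 - q.1.1| *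
      f q.1.1 (q.2.2 + q.2.1 * q.1.1) q.1.2 (q.2.2 + q.2.1 * q.1.2) :=
    Measurable.mul (by fun_prop) (hf' (by fun_prop) (by fun_prop) (by fun_prop) (by fun_prop))
  have h4 := lintegral_lintegral_swap (μ := (volume.prod volume : Measure (ℝ × ℝ)))
    (ν := (volume.prod volume : Measure (ℝ × ℝ)))
    (f := fun q r => ENNReal.ofReal |q.2 - q.1| *
      f q.1 (r.2 + r.1 * q.1) q.2 (r.2 + r.1 * q.2)) h3.aemeasurable
  rw [lintegral_prod _ (Measurable.lintegral_prod_right (f := fun q r : ℝ × ℝ =>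
      ENNReal.ofReal |q.2 - q.1| * f q.1 (r.2 + r.1 * q.1) q.2 (r.2 + r.1 * q.2)) h3).aemeasurable,
    lintegral_prod _ (Measurable.lintegral_prod_left (f := fun q r : ℝ × ℝ =>
      ENNReal.ofReal |q.2 - q.1| * f q.1 (r.2 + r.1 * q.1) q.2 (r.2 + r.1 * q.2)) h3).aemeasurable]
    at h4
  refine (lintegral_congr fun x => lintegral_congr fun x' => ?_).trans
    (h4.trans (lintegral_congr fun s => lintegral_congr fun a => ?_))
  · have h5 := h3.comp (measurable_const (a := (x, x')).prodMk measurable_id)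
    exact (lintegral_prod _ h5.aemeasurable).symm
  · have h5 := h3.comp (measurable_id.prodMk (measurable_const (a := (s, a))))
    exact lintegral_prod _ h5.aemeasurable

theorem lintegral_eq_ofReal_of_hasDerivAt {f F : ℝ → ℝ} (hf0 : ∀ t, 0 ≤ f t)
    (hF : ∀ t, HasDerivAt F (f t) t) (hi : Integrable f) {m n : ℝ}
    (hm : Filter.Tendsto F Filter.atBot (nhds m)) (hn : Filter.Tendsto F Filter.atTop (nhds n)) :
    ∫⁻ t, ENNReal.ofReal (f t) = ENNReal.ofReal (n - m) := by
  rw [← integral_of_hasDerivAt_of_tendsto hF hi hm hn,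
    ofReal_integral_eq_lintegral_ofReal hi (Filter.Eventually.of_forall hf0)]

theorem integrable_inv_one_add_sq_cube : Integrable fun t : ℝ => 1 / (1 + t ^ 2) ^ 3 := by
  refine integrable_inv_one_add_sq.mono' (Continuous.aestronglyMeasurable
    (by fun_prop (disch := intro x; positivity))) (Filter.Eventually.of_forall fun t => ?_)
  rw [Real.norm_of_nonneg (by positivity), ← one_div]
  refine one_div_le_one_div_of_le (by positivity) ?_
  exact le_self_pow₀ (by nlinarith [sq_nonneg t]) (by norm_num)

theorem integrable_sq_div_one_add_sq_cube : Integrable fun t : ℝ => t ^ 2 / (1 + t ^ 2) ^ 3 := by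
  refine integrable_inv_one_add_sq.mono' (Continuous.aestronglyMeasurable
    (by fun_prop (disch := intro x; positivity))) (Filter.Eventually.of_forall fun t => ?_)
  rw [Real.norm_of_nonneg (by positivity), ← one_div,
    div_le_div_iff₀ (by positivity) (by positivity)]
  nlinarith [sq_nonneg t, pow_nonneg (sq_nonneg t) 2, pow_nonneg (sq_nonneg t) 3]

theorem tendsto_div_one_add_sq (l : Filter ℝ)
    (hl : Filter.Tendsto (fun t : ℝ => |t|) l Filter.atTop) :
    Filter.Tendsto (fun t : ℝ => t / (1 + t ^ 2)) l (nhds 0) := by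
  refine squeeze_zero_norm (a := fun t => |t|⁻¹) (fun t => ?_) (tendsto_inv_atTop_zero.comp hl)
  rw [norm_div, Real.norm_eq_abs, Real.norm_of_nonneg (show (0 : ℝ) ≤ 1 + t ^ 2 by positivity)]
  by_cases h : t = 0
  · simp [h]
  · have := abs_pos.2 h
    rw [div_le_iff₀ (by positivity), ← sq_abs, inv_mul_eq_div, le_div_iff₀ this]
    nlinarith

theorem tendsto_div_one_add_sq_sq (l : Filter ℝ)
    (hl : Filter.Tendsto (fun t : ℝ => |t|) l Filter.atTop) :
    Filter.Tendsto (fun t : ℝ => t / (1 + t ^ 2) ^ 2) l (nhds 0) := by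
  refine squeeze_zero_norm (a := fun t => ‖t / (1 + t ^ 2)‖) (fun t => ?_)
    (tendsto_zero_iff_norm_tendsto_zero.1 (tendsto_div_one_add_sq l hl))
  rw [norm_div, norm_div]
  refine div_le_div_of_nonneg_left (norm_nonneg _) (norm_pos_iff.2 (by positivity)) ?_
  rw [Real.norm_of_nonneg (by positivity), Real.norm_of_nonneg (by positivity)]
  exact le_self_pow₀ (by nlinarith [sq_nonneg t]) (by norm_num)

theorem hasDerivAt_arctan_combination (α β γ t : ℝ) :
    HasDerivAt (fun t : ℝ => α * (t / (1 + t ^ 2) ^ 2) + β * (t / (1 + t ^ 2)) + γ * Real.arctan t)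
      (α * ((1 - 3 * t ^ 2) / (1 + t ^ 2) ^ 3) + β * ((1 - t ^ 2) / (1 + t ^ 2) ^ 2)
        + γ * (1 / (1 + t ^ 2))) t := by
  have hp : (1 + t ^ 2) ≠ 0 := by positivity
  have h1 : HasDerivAt (fun t : ℝ => 1 + t ^ 2) (2 * t) t := by
    simpa using (hasDerivAt_pow 2 t).const_add 1
  have h2 := (hasDerivAt_id t).div (h1.pow 2) (pow_ne_zero 2 hp)
  have h3 := (hasDerivAt_id t).div h1 hp
  refine (((h2.const_mul α).add (h3.const_mul β)).add
    ((Real.hasDerivAt_arctan t).const_mul γ)).congr_deriv ?_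
  simp
  field_simp
  ring

theorem tendsto_arctan_combination_atTop (α β γ : ℝ) :
    Filter.Tendsto
      (fun t : ℝ => α * (t / (1 + t ^ 2) ^ 2) + β * (t / (1 + t ^ 2)) + γ * Real.arctan t)
      Filter.atTop (nhds (γ * (Real.pi / 2))) := by
  have h := (((tendsto_div_one_add_sq_sq _ Filter.tendsto_abs_atTop_atTop).const_mul α).add
    ((tendsto_div_one_add_sq _ Filter.tendsto_abs_atTop_atTop).const_mul β)).add
    ((Real.tendsto_arctan_atTop.mono_right nhdsWithin_le_nhds).const_mul γ)
  simpa using h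

theorem tendsto_arctan_combination_atBot (α β γ : ℝ) :
    Filter.Tendsto
      (fun t : ℝ => α * (t / (1 + t ^ 2) ^ 2) + β * (t / (1 + t ^ 2)) + γ * Real.arctan t)
      Filter.atBot (nhds (-(γ * (Real.pi / 2)))) := by
  have h := (((tendsto_div_one_add_sq_sq _ Filter.tendsto_abs_atBot_atTop).const_mul α).add
    ((tendsto_div_one_add_sq _ Filter.tendsto_abs_atBot_atTop).const_mul β)).add
    ((Real.tendsto_arctan_atBot.mono_right nhdsWithin_le_nhds).const_mul γ)
  simpa using h

theorem lintegral_inv_one_add_sq_cube :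
    ∫⁻ t : ℝ, ENNReal.ofReal (1 / (1 + t ^ 2) ^ 3) = ENNReal.ofReal (3 * Real.pi / 8) := by
  rw [lintegral_eq_ofReal_of_hasDerivAt (fun t => by positivity)
    (fun t => (hasDerivAt_arctan_combination (1 / 4) (3 / 8) (3 / 8) t).congr_deriv ?_)
    integrable_inv_one_add_sq_cube (tendsto_arctan_combination_atBot _ _ _)
    (tendsto_arctan_combination_atTop _ _ _)]
  · congr 1; ring
  · field_simp; ring

theorem lintegral_sq_div_one_add_sq_cube :
    ∫⁻ t : ℝ, ENNReal.ofReal (t ^ 2 / (1 + t ^ 2) ^ 3) = ENNReal.ofReal (Real.pi / 8) := by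
  rw [lintegral_eq_ofReal_of_hasDerivAt (fun t => by positivity)
    (fun t => (hasDerivAt_arctan_combination (-1 / 4) (1 / 8) (1 / 8) t).congr_deriv ?_)
    integrable_sq_div_one_add_sq_cube (tendsto_arctan_combination_atBot _ _ _)
    (tendsto_arctan_combination_atTop _ _ _)]
  · congr 1; ring
  · field_simp; ring

theorem lintegral_inv_one_add_sq :
    ∫⁻ t : ℝ, ENNReal.ofReal (1 / (1 + t ^ 2)) = ENNReal.ofReal Real.pi := by
  rw [lintegral_eq_ofReal_of_hasDerivAt (fun t => by positivity)
    (fun t => (hasDerivAt_arctan_combination 0 0 1 t).congr_deriv ?_)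
    (by simpa using integrable_inv_one_add_sq) (tendsto_arctan_combination_atBot _ _ _)
    (tendsto_arctan_combination_atTop _ _ _)]
  · congr 1; ring
  · ring

theorem lintegral_lintegral_sub_sq :
    ∫⁻ t : ℝ, ∫⁻ t' : ℝ, ENNReal.ofReal ((t' - t) ^ 2 / ((1 + t ^ 2) ^ 3 * (1 + t' ^ 2) ^ 3)) =
      ENNReal.ofReal (3 * Real.pi ^ 2 / 32) := by
  set I := ∫⁻ t : ℝ, ∫⁻ t' : ℝ,
    ENNReal.ofReal ((t' - t) ^ 2 / ((1 + t ^ 2) ^ 3 * (1 + t' ^ 2) ^ 3)) with hI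
  have h1 : I = ∫⁻ t : ℝ, ∫⁻ t' : ℝ,
      ENNReal.ofReal ((t' + t) ^ 2 / ((1 + t ^ 2) ^ 3 * (1 + t' ^ 2) ^ 3)) := by
    rw [hI]
    refine lintegral_congr fun t => ?_
    rw [← lintegral_neg_eq_self]
    refine lintegral_congr fun t' => ?_
    congr 2
    · ring
    · ring
  have h2 : I + I = ∫⁻ t : ℝ, ∫⁻ t' : ℝ,
      (ENNReal.ofReal 2 * (ENNReal.ofReal (t ^ 2 / (1 + t ^ 2) ^ 3) *
          ENNReal.ofReal (1 / (1 + t' ^ 2) ^ 3)) +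
        ENNReal.ofReal 2 * (ENNReal.ofReal (1 / (1 + t ^ 2) ^ 3) *
          ENNReal.ofReal (t' ^ 2 / (1 + t' ^ 2) ^ 3))) := by
    conv_lhs => rhs; rw [h1]
    rw [hI, ← lintegral_add_left]
    swap
    · refine Measurable.lintegral_prod_right (f := fun t t' : ℝ =>
        ENNReal.ofReal ((t' - t) ^ 2 / ((1 + t ^ 2) ^ 3 * (1 + t' ^ 2) ^ 3))) ?_
      fun_prop
    refine lintegral_congr fun t => ?_
    rw [← lintegral_add_left (by fun_prop)]
    refine lintegral_congr fun t' => ?_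
    rw [← ENNReal.ofReal_mul (by positivity), ← ENNReal.ofReal_mul (by positivity),
      ← ENNReal.ofReal_mul (by positivity), ← ENNReal.ofReal_mul (by positivity),
      ← ENNReal.ofReal_add (by positivity) (by positivity),
      ← ENNReal.ofReal_add (by positivity) (by positivity)]
    congr 1
    field_simp
    ring
  have h3 : I + I =
      ENNReal.ofReal (3 * Real.pi ^ 2 / 32) + ENNReal.ofReal (3 * Real.pi ^ 2 / 32) := by
    rw [h2]
    have h4 : ∀ t : ℝ, ∫⁻ t' : ℝ,
      (ENNReal.ofReal 2 * (ENNReal.ofReal (t ^ 2 / (1 + t ^ 2) ^ 3) *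
          ENNReal.ofReal (1 / (1 + t' ^ 2) ^ 3)) +
        ENNReal.ofReal 2 * (ENNReal.ofReal (1 / (1 + t ^ 2) ^ 3) *
          ENNReal.ofReal (t' ^ 2 / (1 + t' ^ 2) ^ 3))) =
      ENNReal.ofReal 2 * (ENNReal.ofReal (t ^ 2 / (1 + t ^ 2) ^ 3) *
          ENNReal.ofReal (3 * Real.pi / 8)) +
        ENNReal.ofReal 2 * (ENNReal.ofReal (1 / (1 + t ^ 2) ^ 3) *
          ENNReal.ofReal (Real.pi / 8)) := by
      intro t
      rw [lintegral_add_left (by fun_prop), lintegral_const_mul _ (by fun_prop),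
        lintegral_const_mul _ (by fun_prop), lintegral_const_mul _ (by fun_prop),
        lintegral_const_mul _ (by fun_prop), lintegral_inv_one_add_sq_cube,
        lintegral_sq_div_one_add_sq_cube]
    simp only [h4]
    rw [lintegral_add_left (by fun_prop), lintegral_const_mul _ (by fun_prop),
        lintegral_const_mul _ (by fun_prop), lintegral_mul_const _ (by fun_prop),
        lintegral_mul_const _ (by fun_prop), lintegral_inv_one_add_sq_cube,
        lintegral_sq_div_one_add_sq_cube]
    have := Real.pi_pos
    rw [← ENNReal.ofReal_mul (by positivity), ← ENNReal.ofReal_mul (by positivity),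
      ← ENNReal.ofReal_mul (by positivity), ← ENNReal.ofReal_mul (by positivity)]
    congr 2
    · ring
    · ring
  rw [← two_mul, ← two_mul] at h3
  exact (ENNReal.mul_right_inj two_ne_zero ENNReal.ofNat_ne_top).1 h3

theorem lintegral_line_kernel (s a : ℝ) :
    ∫⁻ x : ℝ, ∫⁻ x' : ℝ, ENNReal.ofReal ((x' - x) ^ 2 /
        ((1 + x ^ 2 + (a + s * x) ^ 2) ^ 3 * (1 + x' ^ 2 + (a + s * x') ^ 2) ^ 3)) =
      ENNReal.ofReal (3 * Real.pi ^ 2 / 32 * ((1 + s ^ 2) ^ 2 / (1 + s ^ 2 + a ^ 2) ^ 4)) := by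
  set A := 1 + s ^ 2 with hA
  have hA0 : 0 < A := by positivity
  have hB0 : 0 < A + a ^ 2 := by positivity
  set k := Real.sqrt (A + a ^ 2) / A with hk
  have hk0 : 0 < k := div_pos (Real.sqrt_pos.2 hB0) hA0
  have hk2 : k ^ 2 = (A + a ^ 2) / A ^ 2 := by rw [hk, div_pow, Real.sq_sqrt hB0.le]
  have hQ : ∀ t, 1 + (k * t + -(a * s / A)) ^ 2 + (a + s * (k * t + -(a * s / A))) ^ 2 =
      (A + a ^ 2) / A * (1 + t ^ 2) := by
    intro t
    have : 1 + (k * t + -(a * s / A)) ^ 2 + (a + s * (k * t + -(a * s / A))) ^ 2 =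
      A * k ^ 2 * t ^ 2 + (1 + (a * s / A) ^ 2 + (a - s * (a * s / A)) ^ 2) := by
      rw [hA]; field_simp; ring
    rw [this, hk2]
    field_simp
    rw [hA]; ring
  have h1 : ∀ x : ℝ, ∫⁻ x' : ℝ, ENNReal.ofReal ((x' - x) ^ 2 /
        ((1 + x ^ 2 + (a + s * x) ^ 2) ^ 3 * (1 + x' ^ 2 + (a + s * x') ^ 2) ^ 3)) =
      ENNReal.ofReal |k| * ∫⁻ t' : ℝ, ENNReal.ofReal ((k * t' + -(a * s / A) - x) ^ 2 /
        ((1 + x ^ 2 + (a + s * x) ^ 2) ^ 3 * ((A + a ^ 2) / A * (1 + t' ^ 2)) ^ 3)) := by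
    intro x
    rw [lintegral_comp_affine _ hk0.ne' (-(a * s / A))]
    simp only [hQ]
  simp only [h1]
  rw [lintegral_comp_affine _ hk0.ne' (-(a * s / A))]
  simp only [hQ]
  have h2 : ∀ t t' : ℝ, ENNReal.ofReal ((k * t' + -(a * s / A) - (k * t + -(a * s / A))) ^ 2 /
      (((A + a ^ 2) / A * (1 + t ^ 2)) ^ 3 * ((A + a ^ 2) / A * (1 + t' ^ 2)) ^ 3)) =
      ENNReal.ofReal (k ^ 2 / ((A + a ^ 2) / A) ^ 6) *
        ENNReal.ofReal ((t' - t) ^ 2 / ((1 + t ^ 2) ^ 3 * (1 + t' ^ 2) ^ 3)) := by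
    intro t t'
    rw [← ENNReal.ofReal_mul (by positivity)]
    congr 1
    field_simp
    ring
  simp only [h2, lintegral_const_mul' _ _ ENNReal.ofReal_ne_top]
  rw [lintegral_lintegral_sub_sq, abs_of_pos hk0, ← ENNReal.ofReal_mul (by positivity),
    ← ENNReal.ofReal_mul (by positivity), ← ENNReal.ofReal_mul (by positivity)]
  congr 1
  have : k * (k * (k ^ 2 / ((A + a ^ 2) / A) ^ 6 * (3 * Real.pi ^ 2 / 32))) =
    (k ^ 2) ^ 2 / ((A + a ^ 2) / A) ^ 6 * (3 * Real.pi ^ 2 / 32) := by ring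
  rw [this, hk2]
  field_simp

theorem lintegral_planar_pairs {ψ : ℝ → ENNReal} (hψ : Measurable ψ) :
    ∫⁻ x : ℝ, ∫⁻ y : ℝ, ∫⁻ x' : ℝ, ∫⁻ y' : ℝ,
      ENNReal.ofReal (4 * |x * y' - y * x'| /
          (Real.pi ^ 2 * ((1 + x ^ 2 + y ^ 2) ^ 3 * (1 + x' ^ 2 + y' ^ 2) ^ 3))) *
        ψ (|x * y' - y * x'| /
          Real.sqrt ((x - x') ^ 2 + (y - y') ^ 2 + (x * y' - y * x') ^ 2)) =
      ENNReal.ofReal (3 * Real.pi / 8) *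
        ∫⁻ p : ℝ, ENNReal.ofReal (|p| / (1 + p ^ 2) ^ 4) * ψ (|p| / Real.sqrt (1 + p ^ 2)) := by
  have hpi := Real.pi_pos
  rw [lintegral_pairs_by_line (f := fun x y x' y' =>
    ENNReal.ofReal (4 * |x * y' - y * x'| /
          (Real.pi ^ 2 * ((1 + x ^ 2 + y ^ 2) ^ 3 * (1 + x' ^ 2 + y' ^ 2) ^ 3))) *
        ψ (|x * y' - y * x'| /
          Real.sqrt ((x - x') ^ 2 + (y - y') ^ 2 + (x * y' - y * x') ^ 2))) (by fun_prop)]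
  have h1 : ∀ s a x x' : ℝ, ENNReal.ofReal |x' - x| *
      (ENNReal.ofReal (4 * |x * (a + s * x') - (a + s * x) * x'| /
          (Real.pi ^ 2 * ((1 + x ^ 2 + (a + s * x) ^ 2) ^ 3 *
            (1 + x' ^ 2 + (a + s * x') ^ 2) ^ 3))) *
        ψ (|x * (a + s * x') - (a + s * x) * x'| /
          Real.sqrt ((x - x') ^ 2 + ((a + s * x) - (a + s * x')) ^ 2
            + (x * (a + s * x') - (a + s * x) * x') ^ 2))) =
      (ENNReal.ofReal (4 * |a| / Real.pi ^ 2) * ψ (|a| / Real.sqrt (1 + s ^ 2 + a ^ 2))) *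
        ENNReal.ofReal ((x' - x) ^ 2 /
        ((1 + x ^ 2 + (a + s * x) ^ 2) ^ 3 * (1 + x' ^ 2 + (a + s * x') ^ 2) ^ 3)) := by
    intro s a x x'
    by_cases hx : x' - x = 0
    · simp [hx]
    have e1 : x * (a + s * x') - (a + s * x) * x' = -(a * (x' - x)) := by ring
    have e2 : (x - x') ^ 2 + ((a + s * x) - (a + s * x')) ^ 2 + (-(a * (x' - x))) ^ 2 =
      (1 + s ^ 2 + a ^ 2) * (x' - x) ^ 2 := by ring
    have hx' := abs_pos.2 hx
    rw [e1, e2, abs_neg, abs_mul, Real.sqrt_mul (by positivity), Real.sqrt_sq_eq_abs,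
      mul_div_mul_right _ _ hx'.ne', ← mul_assoc,
      ← ENNReal.ofReal_mul (by positivity), mul_right_comm (ENNReal.ofReal (4 * |a| / Real.pi ^ 2)),
      ← ENNReal.ofReal_mul (by positivity)]
    congr 2
    rw [← sq_abs (x' - x)]
    generalize (1 + x ^ 2 + (a + s * x) ^ 2) ^ 3 * (1 + x' ^ 2 + (a + s * x') ^ 2) ^ 3 = D
    field_simp
  simp only [h1]
  have h2 : ∀ s a : ℝ, ∫⁻ x : ℝ, ∫⁻ x' : ℝ,
      (ENNReal.ofReal (4 * |a| / Real.pi ^ 2) * ψ (|a| / Real.sqrt (1 + s ^ 2 + a ^ 2))) *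
        ENNReal.ofReal ((x' - x) ^ 2 /
        ((1 + x ^ 2 + (a + s * x) ^ 2) ^ 3 * (1 + x' ^ 2 + (a + s * x') ^ 2) ^ 3)) =
      ENNReal.ofReal (3 * |a| / 8 * ((1 + s ^ 2) ^ 2 / (1 + s ^ 2 + a ^ 2) ^ 4)) *
        ψ (|a| / Real.sqrt (1 + s ^ 2 + a ^ 2)) := by
    intro s a
    have h3 : ∀ x : ℝ, ∫⁻ x' : ℝ,
      (ENNReal.ofReal (4 * |a| / Real.pi ^ 2) * ψ (|a| / Real.sqrt (1 + s ^ 2 + a ^ 2))) *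
        ENNReal.ofReal ((x' - x) ^ 2 /
        ((1 + x ^ 2 + (a + s * x) ^ 2) ^ 3 * (1 + x' ^ 2 + (a + s * x') ^ 2) ^ 3)) =
      (ENNReal.ofReal (4 * |a| / Real.pi ^ 2) * ψ (|a| / Real.sqrt (1 + s ^ 2 + a ^ 2))) *
        ∫⁻ x' : ℝ, ENNReal.ofReal ((x' - x) ^ 2 /
        ((1 + x ^ 2 + (a + s * x) ^ 2) ^ 3 * (1 + x' ^ 2 + (a + s * x') ^ 2) ^ 3)) :=
      fun x => lintegral_const_mul _ (by fun_prop)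
    simp only [h3]
    rw [lintegral_const_mul _ (Measurable.lintegral_prod_right (f := fun x x' : ℝ =>
      ENNReal.ofReal ((x' - x) ^ 2 /
        ((1 + x ^ 2 + (a + s * x) ^ 2) ^ 3 * (1 + x' ^ 2 + (a + s * x') ^ 2) ^ 3))) (by fun_prop)),
      lintegral_line_kernel, mul_right_comm, ← ENNReal.ofReal_mul (by positivity)]
    congr 2
    field_simp
    ring
  simp only [h2]
  have h4 : ∀ s : ℝ, ∫⁻ a : ℝ,
      ENNReal.ofReal (3 * |a| / 8 * ((1 + s ^ 2) ^ 2 / (1 + s ^ 2 + a ^ 2) ^ 4)) *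
        ψ (|a| / Real.sqrt (1 + s ^ 2 + a ^ 2)) =
      ENNReal.ofReal (1 / (1 + s ^ 2)) * (ENNReal.ofReal (3 / 8) *
        ∫⁻ p : ℝ, ENNReal.ofReal (|p| / (1 + p ^ 2) ^ 4) * ψ (|p| / Real.sqrt (1 + p ^ 2))) := by
    intro s
    have hA : 0 < 1 + s ^ 2 := by positivity
    set A := 1 + s ^ 2
    have hr : 0 < Real.sqrt A := Real.sqrt_pos.2 hA
    have hr2 : Real.sqrt A ^ 2 = A := Real.sq_sqrt hA.le
    rw [lintegral_comp_affine _ hr.ne' 0, ← lintegral_const_mul' _ _ ENNReal.ofReal_ne_top,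
      ← lintegral_const_mul' _ _ ENNReal.ofReal_ne_top,
      ← lintegral_const_mul' _ _ ENNReal.ofReal_ne_top]
    refine lintegral_congr fun p => ?_
    have e : A + (Real.sqrt A * p) ^ 2 = A * (1 + p ^ 2) := by rw [mul_pow, hr2]; ring
    rw [add_zero, e, abs_mul, abs_of_pos hr, Real.sqrt_mul hA.le, mul_div_mul_left _ _ hr.ne',
      ← mul_assoc (ENNReal.ofReal (Real.sqrt A)), ← ENNReal.ofReal_mul (by positivity),
      ← mul_assoc (ENNReal.ofReal (1 / A)), ← ENNReal.ofReal_mul (by positivity),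
      ← mul_assoc (ENNReal.ofReal (1 / A * (3 / 8))), ← ENNReal.ofReal_mul (by positivity)]
    congr 2
    have e3 : Real.sqrt A * (3 * (Real.sqrt A * |p|) / 8 * (A ^ 2 / (A * (1 + p ^ 2)) ^ 4)) =
      Real.sqrt A ^ 2 * (3 * |p| / 8 * (A ^ 2 / (A * (1 + p ^ 2)) ^ 4)) := by ring
    rw [e3, hr2]
    field_simp
  simp only [h4]
  rw [lintegral_mul_const _ (by fun_prop), lintegral_inv_one_add_sq, ← mul_assoc,
    ← ENNReal.ofReal_mul (by positivity)]
  congr 2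
  ring

theorem lintegral_comp_div_sqrt_one_add_sq {ψ : ℝ → ENNReal} :
    ∫⁻ p : ℝ, ENNReal.ofReal (|p| / (1 + p ^ 2) ^ 4) * ψ (|p| / Real.sqrt (1 + p ^ 2)) =
      ∫⁻ h in Set.Ioo (-1 : ℝ) 1, ENNReal.ofReal (|h| * (1 - h ^ 2) ^ 2) * ψ |h| := by
  set H : ℝ → ℝ := fun p => p / Real.sqrt (1 + p ^ 2) with hH
  have hpos : ∀ p : ℝ, 0 < 1 + p ^ 2 := fun p => by positivity
  have hspos : ∀ p : ℝ, 0 < Real.sqrt (1 + p ^ 2) := fun p => Real.sqrt_pos.2 (hpos p)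
  have hsq : ∀ p : ℝ, Real.sqrt (1 + p ^ 2) ^ 2 = 1 + p ^ 2 := fun p => Real.sq_sqrt (hpos p).le
  have hH2 : ∀ p, 1 - H p ^ 2 = 1 / (1 + p ^ 2) := by
    intro p
    rw [hH]; dsimp only
    rw [div_pow, hsq]
    have := hpos p
    field_simp; ring
  have hback : ∀ p, H p / Real.sqrt (1 - H p ^ 2) = p := by
    intro p
    rw [hH2, Real.sqrt_div zero_le_one, Real.sqrt_one, hH]
    dsimp only
    have := hspos p
    field_simp
  have himage : H '' Set.univ = Set.Ioo (-1) 1 := by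
    ext h
    constructor
    · rintro ⟨p, -, rfl⟩
      rw [Set.mem_Ioo, ← abs_lt, ← sq_lt_one_iff_abs_lt_one]
      have h1 := hH2 p
      have h2 : 0 < 1 / (1 + p ^ 2) := one_div_pos.2 (hpos p)
      linarith
    · intro hh
      rw [Set.mem_Ioo, ← abs_lt, ← sq_lt_one_iff_abs_lt_one] at hh
      have h1 : 0 < 1 - h ^ 2 := by linarith
      have h2 := Real.sqrt_pos.2 h1
      have h3 := Real.sq_sqrt h1.le
      refine ⟨h / Real.sqrt (1 - h ^ 2), Set.mem_univ _, ?_⟩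
      rw [hH]; dsimp only
      have e : 1 + (h / Real.sqrt (1 - h ^ 2)) ^ 2 = 1 / (1 - h ^ 2) := by
        rw [div_pow, h3]; field_simp; ring
      rw [e, Real.sqrt_div zero_le_one, Real.sqrt_one]
      field_simp
  have hinj : Set.InjOn H Set.univ := by
    intro x _ y _ hxy
    rw [← hback x, ← hback y, hxy]
  have hderiv : ∀ p ∈ Set.univ, HasDerivWithinAt H
      (1 / ((1 + p ^ 2) * Real.sqrt (1 + p ^ 2))) Set.univ p := by
    intro p _
    have h1 : HasDerivAt (fun t : ℝ => 1 + t ^ 2) (2 * p) p := by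
      simpa using (hasDerivAt_pow 2 p).const_add 1
    refine (((hasDerivAt_id p).div (h1.sqrt (hpos p).ne')
      (hspos p).ne').congr_deriv ?_).hasDerivWithinAt
    have h2 := hspos p
    have h3 := hpos p
    rw [hsq]
    simp only [id]
    field_simp
    rw [hsq]
    ring
  rw [← himage, lintegral_image_eq_lintegral_abs_deriv_mul MeasurableSet.univ hderiv hinj,
    setLIntegral_univ]
  refine lintegral_congr fun p => ?_
  have h2 := hspos p
  have h3 := hpos p
  have habs : |H p| = |p| / Real.sqrt (1 + p ^ 2) := by
    rw [hH]; dsimp only; rw [abs_div, abs_of_pos h2]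
  rw [hH2, habs, ← mul_assoc, ← ENNReal.ofReal_mul (abs_nonneg _),
    abs_of_pos (show 0 < 1 / ((1 + p ^ 2) * Real.sqrt (1 + p ^ 2)) by positivity)]
  congr 2
  have e : 1 / ((1 + p ^ 2) * Real.sqrt (1 + p ^ 2)) *
      (|p| / Real.sqrt (1 + p ^ 2) * (1 / (1 + p ^ 2)) ^ 2) =
      |p| / (Real.sqrt (1 + p ^ 2) ^ 2 * (1 + p ^ 2) ^ 3) := by
    field_simp
  rw [e, hsq]
  congr 1
  ring

theorem det3_sq (a b c : EuclideanSpace ℝ (Fin 3)) :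
    det3 a b c ^ 2 = inner ℝ a a * inner ℝ b b * inner ℝ c c +
      2 * inner ℝ a b * inner ℝ b c * inner ℝ c a - inner ℝ a a * inner ℝ b c ^ 2 -
      inner ℝ b b * inner ℝ c a ^ 2 - inner ℝ c c * inner ℝ a b ^ 2 := by
  simp only [inner_fin_three, det3]
  ring

theorem inner_planeNormal_self (a b c : EuclideanSpace ℝ (Fin 3)) :
    inner ℝ (planeNormal a b c) (planeNormal a b c) =
      inner ℝ (b - a) (b - a) * inner ℝ (c - a) (c - a) - inner ℝ (b - a) (c - a) ^ 2 := by
  simp only [inner_fin_three, planeNormal, crossVec, PiLp.sub_apply, PiLp.add_apply,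
    Matrix.cons_val]
  ring

theorem abs_det3_map (R : EuclideanSpace ℝ (Fin 3) ≃ₗᵢ[ℝ] EuclideanSpace ℝ (Fin 3))
    (a b c : EuclideanSpace ℝ (Fin 3)) : |det3 (R a) (R b) (R c)| = |det3 a b c| := by
  rw [← sq_eq_sq_iff_abs_eq_abs, det3_sq, det3_sq]
  simp only [LinearIsometryEquiv.inner_map_map]

theorem norm_planeNormal_map (R : EuclideanSpace ℝ (Fin 3) ≃ₗᵢ[ℝ] EuclideanSpace ℝ (Fin 3))
    (a b c : EuclideanSpace ℝ (Fin 3)) :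
    ‖planeNormal (R a) (R b) (R c)‖ = ‖planeNormal a b c‖ := by
  rw [← sq_eq_sq₀ (norm_nonneg _) (norm_nonneg _), ← real_inner_self_eq_norm_sq,
    ← real_inner_self_eq_norm_sq, inner_planeNormal_self, inner_planeNormal_self]
  simp only [← map_sub, LinearIsometryEquiv.inner_map_map]

@[fun_prop]
theorem Measurable.det3 {α : Type*} [MeasurableSpace α] {f g h : α → EuclideanSpace ℝ (Fin 3)}
    (hf : Measurable f) (hg : Measurable g) (hh : Measurable h) :
    Measurable fun x => det3 (f x) (g x) (h x) := by
  unfold _root_.det3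
  fun_prop

@[fun_prop]
theorem Measurable.crossVec {α : Type*} [MeasurableSpace α] {f g : α → EuclideanSpace ℝ (Fin 3)}
    (hf : Measurable f) (hg : Measurable g) : Measurable fun x => crossVec (f x) (g x) := by
  unfold _root_.crossVec
  refine (PiLp.continuous_toLp 2 _).measurable.comp (measurable_pi_iff.2 fun i => ?_)
  fin_cases i <;> simp <;> fun_prop

@[fun_prop]
theorem Measurable.planeNormal {α : Type*} [MeasurableSpace α]
    {f g h : α → EuclideanSpace ℝ (Fin 3)}
    (hf : Measurable f) (hg : Measurable g) (hh : Measurable h) :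
    Measurable fun x => planeNormal (f x) (g x) (h x) := by
  unfold _root_.planeNormal
  fun_prop

/-- The area-weighted function of the distance from the origin to the plane `abc`. -/
noncomputable def planeWeight (ψ : ℝ → ENNReal) (a b c : EuclideanSpace ℝ (Fin 3)) : ENNReal :=
  ENNReal.ofReal |det3 a b c| * ψ (|det3 a b c| / ‖planeNormal a b c‖)

theorem measurable_planeWeight {α : Type*} [MeasurableSpace α] {ψ : ℝ → ENNReal}
    (hψ : Measurable ψ) {f g h : α → EuclideanSpace ℝ (Fin 3)}
    (hf : Measurable f) (hg : Measurable g) (hh : Measurable h) :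
    Measurable fun x => planeWeight ψ (f x) (g x) (h x) := by
  unfold planeWeight
  have h1 : Measurable fun x => |det3 (f x) (g x) (h x)| := (hf.det3 hg hh).abs
  have h2 := (hf.planeNormal hg hh).norm
  fun_prop

theorem exists_isometry_map_eq {v w : EuclideanSpace ℝ (Fin 3)} (h : ‖v‖ = ‖w‖) :
    ∃ R : EuclideanSpace ℝ (Fin 3) ≃ₗᵢ[ℝ] EuclideanSpace ℝ (Fin 3), R v = w :=
  ⟨Submodule.reflection (ℝ ∙ (v - w))ᗮ, Submodule.reflection_sub h⟩

theorem lintegral_complex {f : ℂ → ENNReal} (hf : Measurable f) :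
    ∫⁻ z, f z = ∫⁻ x : ℝ, ∫⁻ y : ℝ, f ⟨x, y⟩ := by
  rw [← (Complex.volume_preserving_equiv_real_prod.symm).lintegral_comp_emb
    (MeasurableEquiv.measurableEmbedding _) f, Measure.volume_eq_prod, lintegral_prod]
  · rfl
  · exact (hf.comp (MeasurableEquiv.measurable _)).aemeasurable

theorem lintegral_planeWeight_map (ψ : ℝ → ENNReal)
    (R : EuclideanSpace ℝ (Fin 3) ≃ₗᵢ[ℝ] EuclideanSpace ℝ (Fin 3))
    (a : EuclideanSpace ℝ (Fin 3)) :
    ∫⁻ b, ∫⁻ c, planeWeight ψ (R a) b c ∂sphereLaw ∂sphereLaw =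
      ∫⁻ b, ∫⁻ c, planeWeight ψ a b c ∂sphereLaw ∂sphereLaw := by
  have hR : MeasurePreserving R sphereLaw sphereLaw :=
    ⟨R.continuous.measurable, map_sphereLaw R⟩
  have hE : MeasurableEmbedding R := R.toHomeomorph.measurableEmbedding
  rw [← hR.lintegral_comp_emb hE]
  refine lintegral_congr fun b => ?_
  rw [← hR.lintegral_comp_emb hE]
  refine lintegral_congr fun c => ?_
  rw [planeWeight, abs_det3_map, norm_planeNormal_map, planeWeight]

theorem stereoDensity_mul_planeWeight (ψ : ℝ → ENNReal) (x y x' y' : ℝ) :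
    stereoDensity ⟨x, y⟩ * (stereoDensity ⟨x', y'⟩ *
      planeWeight ψ !₂[0, 0, 1] (stereo ⟨x, y⟩) (stereo ⟨x', y'⟩)) =
      ENNReal.ofReal (4 * |x * y' - y * x'| /
          (Real.pi ^ 2 * ((1 + x ^ 2 + y ^ 2) ^ 3 * (1 + x' ^ 2 + y' ^ 2) ^ 3))) *
        ψ (|x * y' - y * x'| /
          Real.sqrt ((x - x') ^ 2 + (y - y') ^ 2 + (x * y' - y * x') ^ 2)) := by
  have e : ∀ u v : ℝ, 1 + Complex.normSq ⟨u, v⟩ = 1 + u ^ 2 + v ^ 2 := fun u v => by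
    rw [Complex.normSq_apply]; ring
  have e' : ∀ u v : ℝ, Complex.normSq ⟨u, v⟩ = u ^ 2 + v ^ 2 := fun u v => by
    rw [Complex.normSq_apply]; ring
  have hq : 0 < 1 + x ^ 2 + y ^ 2 := by positivity
  have hq' : 0 < 1 + x' ^ 2 + y' ^ 2 := by positivity
  have hd : det3 !₂[0, 0, 1] (stereo ⟨x, y⟩) (stereo ⟨x', y'⟩) =
      4 / ((1 + x ^ 2 + y ^ 2) * (1 + x' ^ 2 + y' ^ 2)) * (x * y' - y * x') := by
    simp only [det3, stereo, Matrix.cons_val, e]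
    field_simp
    ring
  have hn : ‖planeNormal !₂[0, 0, 1] (stereo ⟨x, y⟩) (stereo ⟨x', y'⟩)‖ =
      4 / ((1 + x ^ 2 + y ^ 2) * (1 + x' ^ 2 + y' ^ 2)) *
        Real.sqrt ((x - x') ^ 2 + (y - y') ^ 2 + (x * y' - y * x') ^ 2) := by
    rw [← sq_eq_sq₀ (norm_nonneg _) (by positivity), ← real_inner_self_eq_norm_sq,
      inner_planeNormal_self, mul_pow, Real.sq_sqrt (by positivity)]
    simp only [inner_fin_three, PiLp.sub_apply, stereo, Matrix.cons_val, e]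
    simp only [e']
    field_simp
    ring
  have hk : 0 < 4 / ((1 + x ^ 2 + y ^ 2) * (1 + x' ^ 2 + y' ^ 2)) := by positivity
  rw [planeWeight, hd, hn, abs_mul, abs_of_pos hk, mul_div_mul_left _ _ hk.ne', stereoDensity,
    stereoDensity, e, e, ← mul_assoc (ENNReal.ofReal (1 / (Real.pi * (1 + x' ^ 2 + y' ^ 2) ^ 2))),
    ← ENNReal.ofReal_mul (by positivity),
    ← mul_assoc (ENNReal.ofReal (1 / (Real.pi * (1 + x ^ 2 + y ^ 2) ^ 2))),
    ← ENNReal.ofReal_mul (by positivity)]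
  congr 2
  have := Real.pi_pos
  generalize |x * y' - y * x'| = T
  generalize 1 + x ^ 2 + y ^ 2 = q at *
  generalize 1 + x' ^ 2 + y' ^ 2 = q' at *
  field_simp

theorem lintegral_planeWeight {ψ : ℝ → ENNReal} (hψ : Measurable ψ) :
    ∫⁻ a, ∫⁻ b, ∫⁻ c, planeWeight ψ a b c ∂sphereLaw ∂sphereLaw ∂sphereLaw =
      ENNReal.ofReal (3 * Real.pi / 8) *
        ∫⁻ h in Set.Ioo (-1 : ℝ) 1, ENNReal.ofReal (|h| * (1 - h ^ 2) ^ 2) * ψ |h| := by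
  have key : ∫⁻ b, ∫⁻ c, planeWeight ψ !₂[0, 0, 1] b c ∂sphereLaw ∂sphereLaw =
      ENNReal.ofReal (3 * Real.pi / 8) *
        ∫⁻ h in Set.Ioo (-1 : ℝ) 1, ENNReal.ofReal (|h| * (1 - h ^ 2) ^ 2) * ψ |h| := by
    rw [← lintegral_comp_div_sqrt_one_add_sq, ← lintegral_planar_pairs hψ, sphereLaw_eq_stereoLaw,
      lintegral_stereoLaw (Measurable.lintegral_prod_right
        (f := fun b c => planeWeight ψ !₂[0, 0, 1] b c)
        (measurable_planeWeight hψ (by fun_prop) (by fun_prop) (by fun_prop)))]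
    have hs := continuous_stereo.measurable
    have hs2 := measurable_stereoDensity
    have hw : Measurable fun p : ℂ × ℂ => stereoDensity p.2 *
        planeWeight ψ !₂[0, 0, 1] (stereo p.1) (stereo p.2) :=
      (hs2.comp measurable_snd).mul (measurable_planeWeight hψ measurable_const
        (hs.comp measurable_fst) (hs.comp measurable_snd))
    have h1 : ∀ z, ∫⁻ c, planeWeight ψ !₂[0, 0, 1] (stereo z) c ∂stereoLaw =
        ∫⁻ w, stereoDensity w * planeWeight ψ !₂[0, 0, 1] (stereo z) (stereo w) := fun z =>
      lintegral_stereoLaw (measurable_planeWeight hψ measurable_const measurable_const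
        measurable_id)
    simp only [h1]
    have hw2 : Measurable fun z : ℂ => stereoDensity z *
        ∫⁻ w, stereoDensity w * planeWeight ψ !₂[0, 0, 1] (stereo z) (stereo w) :=
      hs2.mul hw.lintegral_prod_right'
    rw [lintegral_complex hw2]
    have h3 : ∀ x y : ℝ, stereoDensity ⟨x, y⟩ * ∫⁻ w, stereoDensity w *
        planeWeight ψ !₂[0, 0, 1] (stereo ⟨x, y⟩) (stereo w) = ∫⁻ x' : ℝ, ∫⁻ y' : ℝ,
        stereoDensity ⟨x, y⟩ * (stereoDensity ⟨x', y'⟩ *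
          planeWeight ψ !₂[0, 0, 1] (stereo ⟨x, y⟩) (stereo ⟨x', y'⟩)) := by
      intro x y
      generalize (⟨x, y⟩ : ℂ) = z
      have hz : stereoDensity z ≠ ⊤ := ENNReal.ofReal_ne_top
      have hw' : Measurable fun w : ℂ => stereoDensity w *
          planeWeight ψ !₂[0, 0, 1] (stereo z) (stereo w) :=
        hs2.mul (measurable_planeWeight hψ measurable_const measurable_const hs)
      rw [lintegral_complex hw', ← lintegral_const_mul' _ _ hz]
      exact lintegral_congr fun x' => (lintegral_const_mul' _ _ hz).symm
    simp only [h3, stereoDensity_mul_planeWeight]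
  have h2 : ∀ᵐ a ∂sphereLaw, ∫⁻ b, ∫⁻ c, planeWeight ψ a b c ∂sphereLaw ∂sphereLaw =
      ENNReal.ofReal (3 * Real.pi / 8) *
        ∫⁻ h in Set.Ioo (-1 : ℝ) 1, ENNReal.ofReal (|h| * (1 - h ^ 2) ^ 2) * ψ |h| := by
    filter_upwards [ae_norm_sphereLaw] with a ha
    have he : ‖a‖ = ‖(!₂[0, 0, 1] : EuclideanSpace ℝ (Fin 3))‖ := by
      rw [ha, ← sq_eq_sq₀ zero_le_one (norm_nonneg _), ← real_inner_self_eq_norm_sq,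
        inner_fin_three]
      simp
    obtain ⟨R, hR⟩ := exists_isometry_map_eq he
    rw [← lintegral_planeWeight_map ψ R, hR, key]
  rw [lintegral_congr_ae h2, lintegral_const, measure_univ, mul_one]

/-- Integrating out the coordinates outside a three-element set. -/
theorem lintegral_pi_indicator {ι α : Type*} [Fintype ι] [MeasurableSpace α] (μ : Measure α)
    [IsProbabilityMeasure μ] {e : Fin 3 → ι} (he : Function.Injective e) {S : Finset ι}
    (hS : ∀ i, i ∈ S ↔ ∃ k, e k = i) {f : (Fin 3 → α) → ENNReal} (hf : Measurable f)
    {Q : (Fin 3 → α) → α → Prop} (hQ : MeasurableSet {p : (Fin 3 → α) × α | Q p.1 p.2}) :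
    ∫⁻ X : ι → α, {X : ι → α | ∀ m ∉ S, Q (X ∘ e) (X m)}.indicator (fun X => f (X ∘ e)) X
        ∂(Measure.pi fun _ => μ) =
      ∫⁻ a, f a * μ {z | Q a z} ^ (Fintype.card ι - 3) ∂(Measure.pi fun _ => μ) := by
  classical
  have hbij : Function.Bijective (Sum.elim e (Subtype.val : {i // i ∉ S} → ι)) := by
    constructor
    · refine he.sumElim Subtype.val_injective fun k m h => m.2 ((hS m).2 ⟨k, h⟩)
    · intro i
      by_cases hi : i ∈ S
      · obtain ⟨k, hk⟩ := (hS i).1 hi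
        exact ⟨Sum.inl k, hk⟩
      · exact ⟨Sum.inr ⟨i, hi⟩, rfl⟩
  let E : Fin 3 ⊕ {i // i ∉ S} ≃ ι := Equiv.ofBijective _ hbij
  have hcard : Fintype.card {i // i ∉ S} = Fintype.card ι - 3 := by
    have := Fintype.card_congr E
    rw [Fintype.card_sum, Fintype.card_fin] at this
    omega
  have h1 := measurePreserving_piCongrLeft (fun _ : ι => μ) E
  have h2 := measurePreserving_sumPiEquivProdPi_symm (fun _ : Fin 3 ⊕ {i // i ∉ S} => μ)
  have hQm : ∀ m, MeasurableSet {X : ι → α | Q (X ∘ e) (X m)} := fun m =>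
    hQ.preimage (f := fun X : ι → α => (X ∘ e, X m)) (by
      refine Measurable.prodMk (measurable_pi_iff.2 fun k => measurable_pi_apply (e k))
        (measurable_pi_apply m))
  have hset : MeasurableSet {X : ι → α | ∀ m ∉ S, Q (X ∘ e) (X m)} := by
    have : {X : ι → α | ∀ m ∉ S, Q (X ∘ e) (X m)} =
        ⋂ m ∈ {m | m ∉ S}, {X : ι → α | Q (X ∘ e) (X m)} := by
      ext X; simp
    rw [this]
    exact MeasurableSet.biInter (Set.to_countable _) fun m _ => hQm m
  set G : Set (ι → α) := {X : ι → α | ∀ m ∉ S, Q (X ∘ e) (X m)} with hG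
  have hF : Measurable (G.indicator fun X => f (X ∘ e)) :=
    (hf.comp (measurable_pi_iff.2 fun k => measurable_pi_apply (e k))).indicator hset
  rw [← h1.lintegral_comp hF, ← h2.lintegral_comp (f := fun Y => G.indicator (fun X => f (X ∘ e))
    (MeasurableEquiv.piCongrLeft (fun _ : ι => α) E Y)) (hF.comp (MeasurableEquiv.measurable _))]
  refine (lintegral_prod _ ((hF.comp (MeasurableEquiv.measurable _)).comp
    (MeasurableEquiv.measurable _)).aemeasurable).trans ?_
  refine lintegral_congr fun a => ?_
  have hΦ1 : ∀ y : {i // i ∉ S} → α, (MeasurableEquiv.piCongrLeft (fun _ : ι => α) E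
      ((MeasurableEquiv.sumPiEquivProdPi fun _ : Fin 3 ⊕ {i // i ∉ S} => α).symm (a, y))) ∘ e = a :=
    fun y => funext fun k => MeasurableEquiv.piCongrLeft_apply_apply E _ (Sum.inl k)
  have hΦ2 : ∀ (y : {i // i ∉ S} → α) (m : {i // i ∉ S}),
      MeasurableEquiv.piCongrLeft (fun _ : ι => α) E
      ((MeasurableEquiv.sumPiEquivProdPi fun _ : Fin 3 ⊕ {i // i ∉ S} => α).symm (a, y)) m = y m :=
    fun y m => MeasurableEquiv.piCongrLeft_apply_apply E _ (Sum.inr m)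
  have hpt : ∀ y : {i // i ∉ S} → α, G.indicator (fun X => f (X ∘ e))
      (MeasurableEquiv.piCongrLeft (fun _ : ι => α) E
        ((MeasurableEquiv.sumPiEquivProdPi fun _ : Fin 3 ⊕ {i // i ∉ S} => α).symm (a, y))) =
      f a * (Set.univ.pi fun _ : {i // i ∉ S} => {z | Q a z}).indicator 1 y := by
    intro y
    have hmem : MeasurableEquiv.piCongrLeft (fun _ : ι => α) E
        ((MeasurableEquiv.sumPiEquivProdPi fun _ : Fin 3 ⊕ {i // i ∉ S} => α).symm (a, y)) ∈ G ↔
        y ∈ Set.univ.pi fun _ : {i // i ∉ S} => {z | Q a z} := by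
      rw [hG, Set.mem_ofPred_eq, hΦ1]
      constructor
      · intro h m _
        have := h m m.2
        rwa [hΦ2] at this
      · intro h m hm
        have := h ⟨m, hm⟩ (Set.mem_univ _)
        rwa [hΦ2 y ⟨m, hm⟩]
    by_cases hy : y ∈ Set.univ.pi fun _ : {i // i ∉ S} => {z | Q a z}
    · rw [Set.indicator_of_mem (hmem.2 hy), Set.indicator_of_mem hy, Pi.one_apply, mul_one, hΦ1]
    · rw [Set.indicator_of_notMem (fun h => hy (hmem.1 h)), Set.indicator_of_notMem hy, mul_zero]
  have hQa : MeasurableSet {z | Q a z} := hQ.preimage measurable_prodMk_left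
  refine (lintegral_congr hpt).trans ?_
  have hpi : MeasurableSet (Set.univ.pi fun _ : {i // i ∉ S} => {z | Q a z}) :=
    MeasurableSet.univ_pi fun _ => hQa
  rw [lintegral_const_mul _ (measurable_one.indicator hpi), lintegral_indicator_one hpi,
    Measure.pi_pi, Finset.prod_const, Finset.card_univ, hcard]

theorem exists_crossVec_ne_zero {a : EuclideanSpace ℝ (Fin 3)} (ha : a ≠ 0) :
    ∃ c, crossVec c a ≠ 0 := by
  by_contra! h
  apply ha
  have h0 := congrArg (fun v : EuclideanSpace ℝ (Fin 3) => v.ofLp) (h !₂[1, 0, 0])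
  have h1 := congrArg (fun v : EuclideanSpace ℝ (Fin 3) => v.ofLp) (h !₂[0, 1, 0])
  have h02 := congrFun h0 2
  have h01 := congrFun h0 1
  have h12 := congrFun h1 2
  simp [crossVec] at h02 h01 h12
  ext i
  fin_cases i <;> simp [h01, h02, h12]

theorem NullOnPlanes.ae_det3_ne_zero {μ : Measure (EuclideanSpace ℝ (Fin 3))}
    (h : NullOnPlanes μ) {a : EuclideanSpace ℝ (Fin 3)} (ha : a ≠ 0) :
    ∀ᵐ b ∂μ, ∀ᵐ c ∂μ, det3 a b c ≠ 0 := by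
  obtain ⟨d, hd⟩ := exists_crossVec_ne_zero ha
  filter_upwards [h.ae_ne hd 0] with b hb
  have hab : crossVec a b ≠ 0 := by
    intro h0
    apply hb
    rw [inner_crossVec, ← det3_rotate, ← det3_rotate, det3_rotate, ← inner_crossVec,
      h0, inner_zero_left]
  filter_upwards [h.ae_ne hab 0] with c hc
  rwa [inner_crossVec, ← det3_rotate] at hc

theorem measurableSet_det3_ne_zero :
    MeasurableSet {a : Fin 3 → EuclideanSpace ℝ (Fin 3) | det3 (a 0) (a 1) (a 2) ≠ 0} := by
  have hm : Measurable fun a : Fin 3 → EuclideanSpace ℝ (Fin 3) => det3 (a 0) (a 1) (a 2) := by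
    fun_prop
  exact hm (measurableSet_singleton 0).compl

theorem lintegral_det3_ne_zero {μ : Measure (EuclideanSpace ℝ (Fin 3))} [IsProbabilityMeasure μ]
    (h : NullOnPlanes μ) (h1 : ∀ᵐ a ∂μ, a ≠ 0) :
    ∫⁻ a, {a | det3 (a 0) (a 1) (a 2) ≠ 0}.indicator 1 a ∂(Measure.pi fun _ : Fin 3 => μ) = 1 := by
  rw [lintegral_pi_fin_three μ _ (measurable_one.indicator measurableSet_det3_ne_zero)]
  have : ∀ᵐ a ∂μ, ∫⁻ b, ∫⁻ c, {a : Fin 3 → EuclideanSpace ℝ (Fin 3) |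
      det3 (a 0) (a 1) (a 2) ≠ 0}.indicator 1 ![a, b, c] ∂μ ∂μ = (1 : ENNReal) := by
    filter_upwards [h1] with a ha
    have : ∀ᵐ b ∂μ, ∫⁻ c, {a : Fin 3 → EuclideanSpace ℝ (Fin 3) |
        det3 (a 0) (a 1) (a 2) ≠ 0}.indicator 1 ![a, b, c] ∂μ = (1 : ENNReal) := by
      filter_upwards [h.ae_det3_ne_zero ha] with b hb
      have : ∀ᵐ c ∂μ, {a : Fin 3 → EuclideanSpace ℝ (Fin 3) |
          det3 (a 0) (a 1) (a 2) ≠ 0}.indicator 1 ![a, b, c] = (1 : ENNReal) := by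
        filter_upwards [hb] with c hc
        rw [Set.indicator_of_mem (show det3 a b c ≠ 0 from hc), Pi.one_apply]
      rw [lintegral_congr_ae this, lintegral_const, measure_univ, mul_one]
    rw [lintegral_congr_ae this, lintegral_const, measure_univ, mul_one]
  rw [lintegral_congr_ae this, lintegral_const, measure_univ, mul_one]

theorem measurable_planeFunctional :
    Measurable fun p : (Fin 3 → EuclideanSpace ℝ (Fin 3)) × EuclideanSpace ℝ (Fin 3) =>
      planeFunctional (p.1 0) (p.1 1) (p.1 2) p.2 := by
  simp only [planeFunctional_apply]
  fun_prop

theorem ae_pointsInGeneralPosition {ι : Type*} [Fintype ι]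
    {μ : Measure (EuclideanSpace ℝ (Fin 3))} [IsProbabilityMeasure μ]
    (h : NullOnPlanes μ) (h1 : ∀ᵐ a ∂μ, a ≠ 0) {e : Finset ι → Fin 3 → ι} (he : IsEnumeration e) :
    ∀ᵐ X ∂(Measure.pi fun _ : ι => μ), PointsInGeneralPosition e X := by
  classical
  have key : ∀ S : Finset ι, ∀ᵐ X ∂(Measure.pi fun _ : ι => μ), S.card = 3 →
      det3 (X (e S 0)) (X (e S 1)) (X (e S 2)) ≠ 0 ∧
        ∀ m ∉ S, faceFunctional e X S (X m) ≠ 1 := by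
    intro S
    by_cases hS : S.card = 3
    swap
    · exact Filter.Eventually.of_forall fun X h => absurd h hS
    have hI := lintegral_pi_indicator μ (he S hS).1 (he S hS).2
      (f := {a | det3 (a 0) (a 1) (a 2) ≠ 0}.indicator 1)
      (measurable_one.indicator measurableSet_det3_ne_zero)
      (Q := fun a z => planeFunctional (a 0) (a 1) (a 2) z ≠ 1)
      (measurable_planeFunctional (measurableSet_singleton 1).compl)
    have hR : ∀ a : Fin 3 → EuclideanSpace ℝ (Fin 3),
        {a : Fin 3 → EuclideanSpace ℝ (Fin 3) | det3 (a 0) (a 1) (a 2) ≠ 0}.indicator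
          (1 : (Fin 3 → EuclideanSpace ℝ (Fin 3)) → ENNReal) a *
          μ {z | planeFunctional (a 0) (a 1) (a 2) z ≠ 1} ^ (Fintype.card ι - 3) =
        {a | det3 (a 0) (a 1) (a 2) ≠ 0}.indicator 1 a := by
      intro a
      by_cases hd : det3 (a 0) (a 1) (a 2) ≠ 0
      · have : μ {z | planeFunctional (a 0) (a 1) (a 2) z ≠ 1} = 1 := by
          rw [← prob_compl_eq_zero_iff₀]
          · rw [← h _ (planeNormal_ne_zero hd) (det3 (a 0) (a 1) (a 2))]
            congr 1
            ext z
            simp only [Set.mem_compl_iff, Set.mem_ofPred_eq, not_not, planeFunctional_apply]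
            rw [inv_mul_eq_one₀ hd, eq_comm]
          · exact ((measurable_planeFunctional.comp measurable_prodMk_left)
              (measurableSet_singleton 1).compl).nullMeasurableSet
        rw [this, one_pow, mul_one]
      · rw [Set.indicator_of_notMem (show a ∉ {a | det3 (a 0) (a 1) (a 2) ≠ 0} from hd), zero_mul]
    rw [lintegral_congr hR, lintegral_det3_ne_zero h h1] at hI
    set G : Set (ι → EuclideanSpace ℝ (Fin 3)) :=
      {X | det3 (X (e S 0)) (X (e S 1)) (X (e S 2)) ≠ 0} ∩
        {X | ∀ m ∉ S, faceFunctional e X S (X m) ≠ 1} with hG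
    have hGm : MeasurableSet G := by
      have : {X : ι → EuclideanSpace ℝ (Fin 3) | ∀ m ∉ S, faceFunctional e X S (X m) ≠ 1} =
          ⋂ m ∈ {m | m ∉ S}, {X | faceFunctional e X S (X m) ≠ 1} := by
        ext X; simp
      rw [hG, this]
      refine MeasurableSet.inter (Measurable.det3 (by fun_prop) (by fun_prop) (by fun_prop)
        (measurableSet_singleton 0).compl)
        (MeasurableSet.biInter (Set.to_countable _) fun m _ => ?_)
      have : Measurable fun X : ι → EuclideanSpace ℝ (Fin 3) => faceFunctional e X S (X m) :=
        measurable_planeFunctional.comp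
          (f := fun X : ι → EuclideanSpace ℝ (Fin 3) => (X ∘ e S, X m))
          (Measurable.prodMk (measurable_pi_iff.2 fun k => measurable_pi_apply (e S k))
            (measurable_pi_apply m))
      exact this (measurableSet_singleton 1).compl
    have hind : ∀ X : ι → EuclideanSpace ℝ (Fin 3),
        {X : ι → EuclideanSpace ℝ (Fin 3) | ∀ m ∉ S,
          planeFunctional ((X ∘ e S) 0) ((X ∘ e S) 1) ((X ∘ e S) 2) (X m) ≠ 1}.indicator
          (fun X => {a : Fin 3 → EuclideanSpace ℝ (Fin 3) | det3 (a 0) (a 1) (a 2) ≠ 0}.indicator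
            (1 : (Fin 3 → EuclideanSpace ℝ (Fin 3)) → ENNReal) (X ∘ e S)) X = G.indicator 1 X := by
      intro X
      by_cases hX : ∀ m ∉ S, faceFunctional e X S (X m) ≠ 1
      · rw [Set.indicator_of_mem (show X ∈ {X : ι → EuclideanSpace ℝ (Fin 3) | ∀ m ∉ S,
          planeFunctional ((X ∘ e S) 0) ((X ∘ e S) 1) ((X ∘ e S) 2) (X m) ≠ 1} from hX)]
        by_cases hd : det3 (X (e S 0)) (X (e S 1)) (X (e S 2)) ≠ 0
        · rw [Set.indicator_of_mem (show X ∈ G from ⟨hd, hX⟩), Set.indicator_of_mem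
            (show X ∘ e S ∈ {a : Fin 3 → EuclideanSpace ℝ (Fin 3) | det3 (a 0) (a 1) (a 2) ≠ 0}
              from hd), Pi.one_apply, Pi.one_apply]
        · rw [Set.indicator_of_notMem (fun h : X ∈ G => hd h.1), Set.indicator_of_notMem
            (show X ∘ e S ∉ {a : Fin 3 → EuclideanSpace ℝ (Fin 3) | det3 (a 0) (a 1) (a 2) ≠ 0}
              from hd)]
      · rw [Set.indicator_of_notMem (fun h : X ∈ G => hX h.2), Set.indicator_of_notMem
          (show X ∉ {X : ι → EuclideanSpace ℝ (Fin 3) | ∀ m ∉ S,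
          planeFunctional ((X ∘ e S) 0) ((X ∘ e S) 1) ((X ∘ e S) 2) (X m) ≠ 1} from hX)]
    have h4 := (lintegral_congr hind).symm.trans hI
    rw [lintegral_indicator_one hGm] at h4
    have h5 : G ∈ ae (Measure.pi fun _ : ι => μ) := by
      rwa [mem_ae_iff_prob_eq_one hGm]
    filter_upwards [h5] with X hX _
    exact hX
  rw [← ae_all_iff] at key
  filter_upwards [key] with X hX
  exact ⟨fun S hS => (hX S hS).1, fun S hS => (hX S hS).2⟩

theorem abs_det3_le_norm_planeNormal {a : EuclideanSpace ℝ (Fin 3)} (ha : ‖a‖ = 1)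
    (b c : EuclideanSpace ℝ (Fin 3)) : |det3 a b c| ≤ ‖planeNormal a b c‖ := by
  have := abs_real_inner_le_norm (planeNormal a b c) a
  rwa [inner_planeNormal_left, ha, mul_one] at this

theorem sphereLaw_planeFunctional_lt_one {a b c : EuclideanSpace ℝ (Fin 3)} (ha : ‖a‖ = 1)
    (hd : det3 a b c ≠ 0) :
    sphereLaw {z | planeFunctional a b c z < 1} =
      ENNReal.ofReal ((1 + |det3 a b c| / ‖planeNormal a b c‖) / 2) := by
  have hN := planeNormal_ne_zero hd
  have hle := abs_det3_le_norm_planeNormal ha b c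
  rcases lt_or_gt_of_ne hd with h | h
  · have : {z | planeFunctional a b c z < 1} =
        {z | det3 a b c < inner ℝ (planeNormal a b c) z} := by
      ext z
      rw [Set.mem_ofPred_eq, Set.mem_ofPred_eq, planeFunctional_apply, inv_mul_eq_div,
        div_lt_one_of_neg h]
    rw [this, sphereLaw_lt_inner hN hle, abs_of_neg h, neg_div, sub_eq_add_neg]
  · have : {z | planeFunctional a b c z < 1} =
        {z | inner ℝ (planeNormal a b c) z < det3 a b c} := by
      ext z
      rw [Set.mem_ofPred_eq, Set.mem_ofPred_eq, planeFunctional_apply, inv_mul_eq_div,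
        div_lt_one h]
    rw [this, sphereLaw_inner_lt hN hle, abs_of_pos h]

theorem sphereLaw_one_lt_planeFunctional {a b c : EuclideanSpace ℝ (Fin 3)} (ha : ‖a‖ = 1)
    (hd : det3 a b c ≠ 0) :
    sphereLaw {z | 1 < planeFunctional a b c z} =
      ENNReal.ofReal ((1 - |det3 a b c| / ‖planeNormal a b c‖) / 2) := by
  have hN := planeNormal_ne_zero hd
  have hle := abs_det3_le_norm_planeNormal ha b c
  rcases lt_or_gt_of_ne hd with h | h
  · have : {z | 1 < planeFunctional a b c z} =
        {z | inner ℝ (planeNormal a b c) z < det3 a b c} := by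
      ext z
      rw [Set.mem_ofPred_eq, Set.mem_ofPred_eq, planeFunctional_apply, inv_mul_eq_div,
        one_lt_div_of_neg h]
    rw [this, sphereLaw_inner_lt hN hle, abs_of_neg h, neg_div, sub_neg_eq_add]
  · have : {z | 1 < planeFunctional a b c z} =
        {z | det3 a b c < inner ℝ (planeNormal a b c) z} := by
      ext z
      rw [Set.mem_ofPred_eq, Set.mem_ofPred_eq, planeFunctional_apply, inv_mul_eq_div,
        one_lt_div h]
    rw [this, sphereLaw_lt_inner hN hle, abs_of_pos h]

/-- The expected contribution of a triple of points, in terms of the probability `ψ` that a further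
point satisfies `Q`. -/
theorem lintegral_indicator_det3 {ι : Type*} [Fintype ι] {e : Fin 3 → ι}
    (he : Function.Injective e) {S : Finset ι} (hS : ∀ i, i ∈ S ↔ ∃ k, e k = i)
    {Q : (Fin 3 → EuclideanSpace ℝ (Fin 3)) → EuclideanSpace ℝ (Fin 3) → Prop}
    (hQ : MeasurableSet {p : (Fin 3 → EuclideanSpace ℝ (Fin 3)) × EuclideanSpace ℝ (Fin 3) |
      Q p.1 p.2}) {ψ : ℝ → ENNReal} (hψ : Measurable ψ)
    (hQψ : ∀ a b c, ‖a‖ = 1 → det3 a b c ≠ 0 →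
      sphereLaw {z | Q ![a, b, c] z} = ψ (|det3 a b c| / ‖planeNormal a b c‖)) :
    ∫⁻ X : ι → EuclideanSpace ℝ (Fin 3), {X : ι → EuclideanSpace ℝ (Fin 3) |
        ∀ m ∉ S, Q (X ∘ e) (X m)}.indicator
          (fun X => ENNReal.ofReal (|det3 (X (e 0)) (X (e 1)) (X (e 2))| / 6)) X
        ∂(Measure.pi fun _ => sphereLaw) =
      ENNReal.ofReal (Real.pi / 16) * ∫⁻ h in Set.Ioo (-1 : ℝ) 1,
        ENNReal.ofReal (|h| * (1 - h ^ 2) ^ 2) * ψ |h| ^ (Fintype.card ι - 3) := by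
  have hm : Measurable fun a : Fin 3 → EuclideanSpace ℝ (Fin 3) =>
      ENNReal.ofReal (|det3 (a 0) (a 1) (a 2)| / 6) := by
    have h : Measurable fun a : Fin 3 → EuclideanSpace ℝ (Fin 3) => |det3 (a 0) (a 1) (a 2)| :=
      (Measurable.det3 (by fun_prop) (by fun_prop) (by fun_prop)).abs
    fun_prop
  refine (lintegral_pi_indicator sphereLaw he hS hm hQ).trans ?_
  have hm2 : Measurable fun a : Fin 3 → EuclideanSpace ℝ (Fin 3) =>
      sphereLaw {z | Q a z} := measurable_measure_prodMk_left hQ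
  rw [lintegral_pi_fin_three sphereLaw (fun a => ENNReal.ofReal (|det3 (a 0) (a 1) (a 2)| / 6) *
    sphereLaw {z | Q a z} ^ (Fintype.card ι - 3)) (hm.mul (hm2.pow_const _))]
  have hp : ∀ᵐ a ∂sphereLaw, ∫⁻ b, ∫⁻ c,
      ENNReal.ofReal (|det3 (![a, b, c] 0) (![a, b, c] 1) (![a, b, c] 2)| / 6) *
        sphereLaw {z | Q ![a, b, c] z} ^ (Fintype.card ι - 3) ∂sphereLaw ∂sphereLaw =
      ENNReal.ofReal (1 / 6) * ∫⁻ b, ∫⁻ c,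
        planeWeight (fun h => ψ h ^ (Fintype.card ι - 3)) a b c ∂sphereLaw ∂sphereLaw := by
    filter_upwards [ae_norm_sphereLaw] with a ha
    rw [← lintegral_const_mul' _ _ ENNReal.ofReal_ne_top]
    refine lintegral_congr fun b => ?_
    rw [← lintegral_const_mul' _ _ ENNReal.ofReal_ne_top]
    refine lintegral_congr fun c => ?_
    change ENNReal.ofReal (|det3 a b c| / 6) * _ = _
    by_cases hd : det3 a b c = 0
    · simp [planeWeight, hd]
    · rw [hQψ a b c ha hd, planeWeight, ← mul_assoc, ← ENNReal.ofReal_mul (by norm_num)]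
      congr 2
      ring
  rw [lintegral_congr_ae hp, lintegral_const_mul' _ _ ENNReal.ofReal_ne_top,
    lintegral_planeWeight (hψ.pow_const _), ← mul_assoc, ← ENNReal.ofReal_mul (by norm_num)]
  congr 2
  ring

theorem lintegral_Ioo_kernel (m : ℕ) {g : ℝ → ℝ} (hg : Continuous g)
    (hg0 : ∀ h ∈ Set.Ioo (-1 : ℝ) 1, 0 ≤ g |h|) :
    ∫⁻ h in Set.Ioo (-1 : ℝ) 1,
        ENNReal.ofReal (|h| * (1 - h ^ 2) ^ 2) * ENNReal.ofReal (g |h|) ^ m =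
      ENNReal.ofReal (∫ h in (-1 : ℝ)..1, |h| * (1 - h ^ 2) ^ 2 * g |h| ^ m) := by
  have hc : Continuous fun h : ℝ => |h| * (1 - h ^ 2) ^ 2 * g |h| ^ m := by fun_prop
  rw [intervalIntegral.integral_of_le (by norm_num), integral_Ioc_eq_integral_Ioo,
    ofReal_integral_eq_lintegral_ofReal]
  · refine setLIntegral_congr_fun measurableSet_Ioo fun h hh => ?_
    rw [← ENNReal.ofReal_pow (hg0 h hh), ← ENNReal.ofReal_mul (by positivity)]
  · exact (hc.integrableOn_Icc (a := -1) (b := 1)).mono_set Set.Ioo_subset_Icc_self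
  · filter_upwards [ae_restrict_mem measurableSet_Ioo] with h hh
    have := hg0 h hh
    simp only [Pi.zero_apply]
    positivity

theorem integral_kernel (m : ℕ) :
    ∫ h in (-1 : ℝ)..1, h * (1 - h ^ 2) ^ 2 * ((1 + h) / 2) ^ m =
      32 * (2 / ((m : ℝ) + 6) - 5 / ((m : ℝ) + 5) + 4 / ((m : ℝ) + 4) - 1 / ((m : ℝ) + 3)) := by
  have h1 := intervalIntegral.mul_integral_comp_mul_sub (a := 0) (b := 1)
    (f := fun h : ℝ => h * (1 - h ^ 2) ^ 2 * ((1 + h) / 2) ^ m) 2 1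
  rw [show (2 : ℝ) * 0 - 1 = -1 by norm_num, show (2 : ℝ) * 1 - 1 = 1 by norm_num] at h1
  rw [← h1]
  have h2 : ∀ u : ℝ, (2 * u - 1) * (1 - (2 * u - 1) ^ 2) ^ 2 * ((1 + (2 * u - 1)) / 2) ^ m =
      16 * (2 * u ^ (m + 5) - 5 * u ^ (m + 4) + 4 * u ^ (m + 3) - u ^ (m + 2)) := by
    intro u
    rw [show (1 + (2 * u - 1)) / 2 = u by ring]
    ring
  have hi : ∀ k : ℕ, IntervalIntegrable (fun u : ℝ => u ^ k) volume 0 1 := fun k =>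
    (continuous_pow k).intervalIntegrable _ _
  simp only [h2]
  rw [intervalIntegral.integral_const_mul, intervalIntegral.integral_sub
    ((((hi _).const_mul _).sub ((hi _).const_mul _)).add ((hi _).const_mul _)) (hi _),
    intervalIntegral.integral_add (((hi _).const_mul _).sub ((hi _).const_mul _))
      ((hi _).const_mul _),
    intervalIntegral.integral_sub ((hi _).const_mul _) ((hi _).const_mul _)]
  simp only [intervalIntegral.integral_const_mul, integral_pow]
  push_cast
  simp
  ring

theorem integral_abs_kernel_sub (m : ℕ) :
    (∫ h in (-1 : ℝ)..1, |h| * (1 - h ^ 2) ^ 2 * ((1 + |h|) / 2) ^ m) -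
      ∫ h in (-1 : ℝ)..1, |h| * (1 - h ^ 2) ^ 2 * ((1 - |h|) / 2) ^ m =
      64 * (2 / ((m : ℝ) + 6) - 5 / ((m : ℝ) + 5) + 4 / ((m : ℝ) + 4) - 1 / ((m : ℝ) + 3)) := by
  have hc1 : Continuous fun h : ℝ => |h| * (1 - h ^ 2) ^ 2 * ((1 + |h|) / 2) ^ m := by fun_prop
  have hc2 : Continuous fun h : ℝ => |h| * (1 - h ^ 2) ^ 2 * ((1 - |h|) / 2) ^ m := by fun_prop
  have hc3 : Continuous fun h : ℝ => h * (1 - h ^ 2) ^ 2 * ((1 + h) / 2) ^ m := by fun_prop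
  have hc4 : Continuous fun h : ℝ => h * (1 - h ^ 2) ^ 2 * ((1 - h) / 2) ^ m := by fun_prop
  have h5 : ∫ h in (-1 : ℝ)..1, h * (1 - h ^ 2) ^ 2 * ((1 - h) / 2) ^ m =
      -∫ h in (-1 : ℝ)..1, h * (1 - h ^ 2) ^ 2 * ((1 + h) / 2) ^ m := by
    rw [← intervalIntegral.integral_neg]
    have := intervalIntegral.integral_comp_neg (a := -1) (b := 1)
      (fun h : ℝ => h * (1 - h ^ 2) ^ 2 * ((1 - h) / 2) ^ m)
    rw [neg_neg] at this
    rw [← this]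
    congr 1
    ext h
    ring
  rw [← intervalIntegral.integral_sub (hc1.intervalIntegrable _ _) (hc2.intervalIntegrable _ _)]
  have h6 : ∀ h : ℝ, |h| * (1 - h ^ 2) ^ 2 * ((1 + |h|) / 2) ^ m -
      |h| * (1 - h ^ 2) ^ 2 * ((1 - |h|) / 2) ^ m =
      h * (1 - h ^ 2) ^ 2 * ((1 + h) / 2) ^ m - h * (1 - h ^ 2) ^ 2 * ((1 - h) / 2) ^ m := by
    intro h
    rcases abs_cases h with ⟨h1, -⟩ | ⟨h1, -⟩
    · rw [h1]
    · rw [h1]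
      ring
  simp only [h6]
  rw [intervalIntegral.integral_sub (hc3.intervalIntegrable _ _) (hc4.intervalIntegrable _ _),
    h5, integral_kernel]
  ring

/-- The part of the space of point configurations where all points outside the triple `S` satisfy a
condition relative to that triple is measurable. -/
theorem measurableSet_forall_notMem {ι : Type*} [Fintype ι] (f : Fin 3 → ι) (S : Finset ι)
    {Q : (Fin 3 → EuclideanSpace ℝ (Fin 3)) → EuclideanSpace ℝ (Fin 3) → Prop}
    (hQ : MeasurableSet {p : (Fin 3 → EuclideanSpace ℝ (Fin 3)) × EuclideanSpace ℝ (Fin 3) |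
      Q p.1 p.2}) :
    MeasurableSet {X : ι → EuclideanSpace ℝ (Fin 3) | ∀ m ∉ S, Q (X ∘ f) (X m)} := by
  simp only [Set.ofPred_forall]
  refine MeasurableSet.iInter fun m => MeasurableSet.iInter fun _ => ?_
  have h : Measurable fun X : ι → EuclideanSpace ℝ (Fin 3) => (X ∘ f, X m) := by
    refine Measurable.prodMk (measurable_pi_lambda _ fun k => ?_) (measurable_pi_apply m)
    exact measurable_pi_apply (f k)
  exact h hQ

theorem lintegral_sum_indicator_det3 {ι : Type*} [Fintype ι] {e : Finset ι → Fin 3 → ι}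
    (he : IsEnumeration e)
    {Q : (Fin 3 → EuclideanSpace ℝ (Fin 3)) → EuclideanSpace ℝ (Fin 3) → Prop}
    (hQ : MeasurableSet {p : (Fin 3 → EuclideanSpace ℝ (Fin 3)) × EuclideanSpace ℝ (Fin 3) |
      Q p.1 p.2}) {g : ℝ → ℝ} (hg : Continuous g)
    (hg0 : ∀ h ∈ Set.Ioo (-1 : ℝ) 1, 0 ≤ g |h|)
    (hQg : ∀ a b c, ‖a‖ = 1 → det3 a b c ≠ 0 →
      sphereLaw {z | Q ![a, b, c] z} = ENNReal.ofReal (g (|det3 a b c| / ‖planeNormal a b c‖))) :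
    Measurable (fun X : ι → EuclideanSpace ℝ (Fin 3) =>
      ∑ S ∈ Finset.powersetCard 3 (Finset.univ : Finset ι),
        {X : ι → EuclideanSpace ℝ (Fin 3) | ∀ m ∉ S, Q (X ∘ e S) (X m)}.indicator
          (fun X => ENNReal.ofReal (|det3 (X (e S 0)) (X (e S 1)) (X (e S 2))| / 6)) X) ∧
    ∫⁻ X : ι → EuclideanSpace ℝ (Fin 3),
      ∑ S ∈ Finset.powersetCard 3 (Finset.univ : Finset ι),
        {X : ι → EuclideanSpace ℝ (Fin 3) | ∀ m ∉ S, Q (X ∘ e S) (X m)}.indicator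
          (fun X => ENNReal.ofReal (|det3 (X (e S 0)) (X (e S 1)) (X (e S 2))| / 6)) X
        ∂(Measure.pi fun _ => sphereLaw) =
      ENNReal.ofReal ((Fintype.card ι).choose 3 * (Real.pi / 16 *
        ∫ h in (-1 : ℝ)..1, |h| * (1 - h ^ 2) ^ 2 * g |h| ^ (Fintype.card ι - 3))) := by
  have hm : ∀ S, Measurable ({X : ι → EuclideanSpace ℝ (Fin 3) |
      ∀ m ∉ S, Q (X ∘ e S) (X m)}.indicator
        (fun X => ENNReal.ofReal (|det3 (X (e S 0)) (X (e S 1)) (X (e S 2))| / 6))) := by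
    intro S
    refine Measurable.indicator ?_ (measurableSet_forall_notMem _ _ hQ)
    have h : Measurable fun X : ι → EuclideanSpace ℝ (Fin 3) =>
        |det3 (X (e S 0)) (X (e S 1)) (X (e S 2))| :=
      (Measurable.det3 (by fun_prop) (by fun_prop) (by fun_prop)).abs
    fun_prop
  refine ⟨Finset.measurable_fun_sum _ fun S _ => hm S, ?_⟩
  rw [lintegral_finsetSum _ fun S _ => hm S]
  have hS : ∀ S ∈ Finset.powersetCard 3 (Finset.univ : Finset ι),
      ∫⁻ X, {X : ι → EuclideanSpace ℝ (Fin 3) | ∀ m ∉ S, Q (X ∘ e S) (X m)}.indicator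
          (fun X => ENNReal.ofReal (|det3 (X (e S 0)) (X (e S 1)) (X (e S 2))| / 6)) X
        ∂(Measure.pi fun _ => sphereLaw) =
      ENNReal.ofReal (Real.pi / 16 *
        ∫ h in (-1 : ℝ)..1, |h| * (1 - h ^ 2) ^ 2 * g |h| ^ (Fintype.card ι - 3)) := by
    intro S hS
    obtain ⟨h1, h2⟩ := he S (Finset.mem_powersetCard.1 hS).2
    rw [lintegral_indicator_det3 h1 h2 hQ (ψ := fun h => ENNReal.ofReal (g h))
      (by fun_prop) hQg, lintegral_Ioo_kernel _ hg hg0,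
      ← ENNReal.ofReal_mul (by positivity)]
  rw [Finset.sum_congr rfl hS, Finset.sum_const, Finset.card_powersetCard, Finset.card_univ,
    nsmul_eq_mul, ENNReal.ofReal_mul (Nat.cast_nonneg _), ENNReal.ofReal_natCast]

theorem integral_abs_kernel_nonneg (m : ℕ) {g : ℝ → ℝ}
    (hg0 : ∀ h ∈ Set.Icc (-1 : ℝ) 1, 0 ≤ g |h|) :
    0 ≤ ∫ h in (-1 : ℝ)..1, |h| * (1 - h ^ 2) ^ 2 * g |h| ^ m := by
  refine intervalIntegral.integral_nonneg (by norm_num) fun h hh => ?_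
  have := hg0 h hh
  positivity

theorem integral_volume_convexHull_sphereLaw (n : ℕ) (hn : 4 ≤ n) :
    ∫ X : Fin n → EuclideanSpace ℝ (Fin 3), (volume (convexHull ℝ (Set.range X))).toReal
        ∂(Measure.pi fun _ => sphereLaw) =
      (4 * Real.pi / 3) * (((n : ℝ) - 1) * ((n : ℝ) - 2) * ((n : ℝ) - 3)) /
          (((n : ℝ) + 1) * ((n : ℝ) + 2) * ((n : ℝ) + 3)) := by
  classical
  have : Nonempty (Fin n) := ⟨⟨0, by omega⟩⟩
  obtain ⟨e, he⟩ := exists_isEnumeration (ι := Fin n)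
  have hplus : ∀ h ∈ Set.Icc (-1 : ℝ) 1, 0 ≤ (1 + |h|) / 2 := fun h _ => by positivity
  have hminus : ∀ h ∈ Set.Icc (-1 : ℝ) 1, 0 ≤ (1 - |h|) / 2 := fun h hh => by
    have := abs_le.2 hh
    linarith
  obtain ⟨hUm, hU⟩ := lintegral_sum_indicator_det3 he
    (Q := fun a z => planeFunctional (a 0) (a 1) (a 2) z < 1)
    (measurableSet_lt measurable_planeFunctional measurable_const)
    (g := fun h => (1 + h) / 2) (by fun_prop)
    (fun h hh => hplus h (Set.Ioo_subset_Icc_self hh))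
    (fun a b c ha hd => sphereLaw_planeFunctional_lt_one ha hd)
  obtain ⟨hLm, hL⟩ := lintegral_sum_indicator_det3 he
    (Q := fun a z => 1 < planeFunctional (a 0) (a 1) (a 2) z)
    (measurableSet_lt measurable_const measurable_planeFunctional)
    (g := fun h => (1 - h) / 2) (by fun_prop)
    (fun h hh => hminus h (Set.Ioo_subset_Icc_self hh))
    (fun a b c ha hd => sphereLaw_one_lt_planeFunctional ha hd)
  rw [Fintype.card_fin] at hU hL
  set U : (Fin n → EuclideanSpace ℝ (Fin 3)) → ENNReal := fun X =>
    ∑ S ∈ Finset.powersetCard 3 Finset.univ, {X : Fin n → EuclideanSpace ℝ (Fin 3) | ∀ m ∉ S,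
      planeFunctional ((X ∘ e S) 0) ((X ∘ e S) 1) ((X ∘ e S) 2) (X m) < 1}.indicator
      (fun X => ENNReal.ofReal (|det3 (X (e S 0)) (X (e S 1)) (X (e S 2))| / 6)) X with hUdef
  set L : (Fin n → EuclideanSpace ℝ (Fin 3)) → ENNReal := fun X =>
    ∑ S ∈ Finset.powersetCard 3 Finset.univ, {X : Fin n → EuclideanSpace ℝ (Fin 3) | ∀ m ∉ S,
      1 < planeFunctional ((X ∘ e S) 0) ((X ∘ e S) 1) ((X ∘ e S) 2) (X m)}.indicator
      (fun X => ENNReal.ofReal (|det3 (X (e S 0)) (X (e S 1)) (X (e S 2))| / 6)) X with hLdef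
  have hLfin : ∀ X, L X ≠ ⊤ := fun X => by
    refine ENNReal.sum_ne_top.2 fun S _ => ?_
    refine ne_top_of_le_ne_top ENNReal.ofReal_ne_top (Set.indicator_le_self _ _ X)
  have hVL : ∀ᵐ X ∂(Measure.pi fun _ : Fin n => sphereLaw),
      volume (convexHull ℝ (Set.range X)) + L X = U X := by
    have h0 : ∀ᵐ a ∂sphereLaw, a ≠ 0 := ae_norm_sphereLaw.mono fun a ha h => by
      simp [h] at ha
    filter_upwards [ae_pointsInGeneralPosition nullOnPlanes_sphereLaw h0 he] with X hX
    have h := hX.volume_convexHull he (by simp only [Fintype.card_fin]; omega)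
    rw [hUdef, hLdef]
    simp only [Set.indicator_apply, Set.mem_ofPred_eq]
    have hif : ∀ (p : Prop) (d₁ d₂ : Decidable p) (x : ENNReal),
        @ite _ p d₁ x 0 = @ite _ p d₂ x 0 := fun p d₁ d₂ x => by
      rw [Subsingleton.elim d₁ d₂]
    refine Eq.trans ?_ (h.trans ?_)
    · exact congrArg _ (Finset.sum_congr rfl fun S _ => hif _ _ _ _)
    · exact Finset.sum_congr rfl fun S _ => hif _ _ _ _
  have hVeq : (fun X : Fin n → EuclideanSpace ℝ (Fin 3) => volume (convexHull ℝ (Set.range X)))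
      =ᵐ[Measure.pi fun _ => sphereLaw] fun X => U X - L X :=
    hVL.mono fun X hX => ENNReal.eq_sub_of_add_eq (hLfin X) hX
  have hVm : AEMeasurable (fun X : Fin n → EuclideanSpace ℝ (Fin 3) =>
      volume (convexHull ℝ (Set.range X))) (Measure.pi fun _ => sphereLaw) :=
    (hUm.sub hLm).aemeasurable.congr hVeq.symm
  have hsum : ∫⁻ X : Fin n → EuclideanSpace ℝ (Fin 3), volume (convexHull ℝ (Set.range X))
        ∂(Measure.pi fun _ => sphereLaw) + ∫⁻ X, L X ∂(Measure.pi fun _ => sphereLaw) =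
      ∫⁻ X, U X ∂(Measure.pi fun _ => sphereLaw) := by
    rw [← lintegral_add_right _ hLm]
    exact lintegral_congr_ae hVL
  rw [integral_toReal hVm (ae_of_all _ fun X =>
    ((Set.finite_range X).isCompact_convexHull ℝ).measure_lt_top)]
  have h1 : (0 : ℝ) ≤ n.choose 3 * (Real.pi / 16 *
      ∫ h in (-1 : ℝ)..1, |h| * (1 - h ^ 2) ^ 2 * ((1 - |h|) / 2) ^ (n - 3)) := by
    have := integral_abs_kernel_nonneg (n - 3) (g := fun h => (1 - h) / 2) hminus
    positivity
  rw [ENNReal.eq_sub_of_add_eq (by rw [hL]; exact ENNReal.ofReal_ne_top) hsum, hU, hL,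
    ← ENNReal.ofReal_sub _ h1, ← mul_sub, ← mul_sub, integral_abs_kernel_sub]
  obtain ⟨m, rfl⟩ : ∃ m, n = m + 3 := ⟨n - 3, by omega⟩
  have hval : ((m + 3).choose 3 : ℝ) = (m + 3) * (m + 2) * (m + 1) / 6 := by
    have h := Nat.descFactorial_eq_factorial_mul_choose (m + 3) 3
    simp only [Nat.descFactorial, Nat.factorial] at h
    have h' := congrArg (Nat.cast : ℕ → ℝ) h
    push_cast [show m + 3 - 2 = m + 1 by omega, show m + 3 - 1 = m + 2 by omega,
      show m + 3 - 0 = m + 3 by omega] at h'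
    linarith
  have hm : (0 : ℝ) ≤ m := Nat.cast_nonneg m
  have hfin : ((m + 3).choose 3 : ℝ) * (Real.pi / 16 * (64 * (2 / ((m : ℝ) + 6) -
      5 / ((m : ℝ) + 5) + 4 / ((m : ℝ) + 4) - 1 / ((m : ℝ) + 3)))) =
      4 * Real.pi / 3 * (((m : ℝ) + 2) * (m + 1) * m) /
        (((m : ℝ) + 4) * (m + 5) * (m + 6)) := by
    rw [hval]
    field_simp
    ring
  rw [show m + 3 - 3 = m by omega, hfin, ENNReal.toReal_ofReal (by positivity)]
  push_cast
  ring

/-- Expected volume of the convex hull of `n` i.i.d. uniform points on the unit sphere in `ℝ³`. -/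
theorem expected_volume_sphere_hull (n : ℕ) (hn : 4 ≤ n) :
    let σ : Measure (EuclideanSpace ℝ (Fin 3)) :=
      (μH[2] : Measure (EuclideanSpace ℝ (Fin 3))).restrict (Metric.sphere 0 1)
    let μ : Measure (EuclideanSpace ℝ (Fin 3)) := (σ Set.univ)⁻¹ • σ
    (∫ X : Fin n → EuclideanSpace ℝ (Fin 3),
        (volume (convexHull ℝ (Set.range X))).toReal ∂(Measure.pi fun _ => μ))
      = (4 * Real.pi / 3) * (((n : ℝ) - 1) * ((n : ℝ) - 2) * ((n : ℝ) - 3)) /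
          (((n : ℝ) + 1) * ((n : ℝ) + 2) * ((n : ℝ) + 3)) := by
  exact integral_volume_convexHull_sphereLaw n hn
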